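/- arXiv:0804.4842 — 2 statements merged into one kernel-verified Lean document; each statement's English description precedes it below -/
import Mathlib

section
/- Let (Σ) be quasi-regular at a minimal prime differential ideal 𝔓 satisfying the standing rank hypothesis. Then the Hilbert–Kolchin regularity of 𝔓 is bounded by e−1; in particular, for first-order systems (e = 1), trdeg_K Frac(A_i/(A_i∩𝔓)) = (n−r)(i+1) + ord(𝔓) for all i ∈ ℕ₀. -/
set_option synthInstance.maxHeartbeats 1000000
set_option maxHeartbeats 4000000

noncomputable section

namespace DAE

open MvPolynomial

/-- The ring of differential polynomials `K{X_1,…,X_n}`: the polynomial ring in the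
variables `X_j^{(l)}`, `1 ≤ j ≤ n`, `l ∈ ℕ`. -/
abbrev DP (K : Type) [Field K] (n : ℕ) : Type := MvPolynomial (Fin n × ℕ) K

variable {K : Type} [Field K] {n : ℕ}

/-- `δ : K → K` is a derivation of the field `K`. -/
structure IsDeriv (K : Type) [Field K] (δ : K → K) : Prop where
  map_add : ∀ a b, δ (a + b) = δ a + δ b
  leibniz : ∀ a b, δ (a * b) = a * δ b + b * δ a

/-- `D` is the total derivation of `K{X}` extending the derivation `δ` of `K`, with
`D X_j^{(l)} = X_j^{(l+1)}`. The `p`-th total derivative of `g` is `D^[p] g`. -/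
structure IsTotalDeriv (K : Type) [Field K] (n : ℕ) (δ : K → K) (D : DP K n → DP K n) : Prop where
  map_add : ∀ f g, D (f + g) = D f + D g
  leibniz : ∀ f g, D (f * g) = f * D g + g * D f
  map_C : ∀ a : K, D (C a) = C (δ a)
  map_X : ∀ (j : Fin n) (l : ℕ), D (X (j, l)) = X (j, l + 1)

/-- the maximal order of derivation of `X_j` appearing in `f` (`0` when absent) -/
def ordIn (f : DP K n) (j : Fin n) : ℕ :=
  (f.vars.filter fun v => v.1 = j).sup fun v => v.2

/-- some derivative of `X_j` appears in `f` -/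
def appearsIn (f : DP K n) (j : Fin n) : Prop :=
  (f.vars.filter fun v => v.1 = j).Nonempty

instance {K : Type} [Field K] {n : ℕ} (f : DP K n) (j : Fin n) : Decidable (appearsIn f j) := by
  unfold appearsIn; infer_instance

/-- the order of `f`: maximal order of derivation of a variable appearing in `f` -/
def ordOf (f : DP K n) : ℕ := f.vars.sup fun v => v.2

/-- `I` is a differential ideal (stable under the total derivation `D`) -/
def IsDiffIdeal (D : DP K n → DP K n) (I : Ideal (DP K n)) : Prop := ∀ g ∈ I, D g ∈ I

/-- the differential ideal `[f_1,…,f_r]` generated by `f_1,…,f_r` -/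
def diffIdealGen (D : DP K n → DP K n) {r : ℕ} (f : Fin r → DP K n) : Ideal (DP K n) :=
  sInf {I | (∀ t, f t ∈ I) ∧ IsDiffIdeal D I}

/-- `𝔓` is a prime differential ideal, minimal among those containing `f_1,…,f_r` -/
def IsMinimalPrimeDiff (D : DP K n → DP K n) {r : ℕ} (f : Fin r → DP K n)
    (𝔓 : Ideal (DP K n)) : Prop :=
  𝔓.IsPrime ∧ IsDiffIdeal D 𝔓 ∧ (∀ t, f t ∈ 𝔓) ∧
    ∀ Q : Ideal (DP K n), Q.IsPrime → IsDiffIdeal D Q → (∀ t, f t ∈ Q) → Q ≤ 𝔓 → Q = 𝔓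

/-- the polynomial ring `A_i := K[X^{[i]}]` -/
abbrev AP (K : Type) [Field K] (n i : ℕ) : Type := MvPolynomial (Fin n × Fin (i + 1)) K

/-- the inclusion `A_i ↪ K{X}` -/
def inclA (K : Type) [Field K] (n i : ℕ) : AP K n i →+* DP K n :=
  (rename fun v : Fin n × Fin (i + 1) => ((v.1, (v.2 : ℕ)) : Fin n × ℕ)).toRingHom

/-- the truncation `K{X} → A_i` (a retraction of `inclA`, exact on polynomials of
order at most `i`) -/
def truncA (K : Type) [Field K] (n i : ℕ) : DP K n →+* AP K n i :=
  (aeval fun v : Fin n × ℕ =>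
    if h : v.2 < i + 1 then (X (v.1, ⟨v.2, h⟩) : AP K n i) else 0).toRingHom

/-- the contraction `A_i ∩ 𝔓` -/
def Pc {K : Type} [Field K] {n : ℕ} (i : ℕ) (𝔓 : Ideal (DP K n)) : Ideal (AP K n i) :=
  𝔓.comap (inclA K n i)

instance {K : Type} [Field K] {n : ℕ} (i : ℕ) (𝔓 : Ideal (DP K n)) [𝔓.IsPrime] :
    (Pc i 𝔓).IsPrime := Ideal.IsPrime.comap _

/-- the local ring `B_i`: the localization of `A_i` at the prime `A_i ∩ 𝔓` -/
abbrev BL (K : Type) [Field K] (n : ℕ) (i : ℕ) (𝔓 : Ideal (DP K n)) [𝔓.IsPrime] : Type :=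
  Localization.AtPrime (Pc (K := K) (n := n) i 𝔓)

/-- the transition map `A_i → A_{i'}` for `i ≤ i'` -/
def renAA (K : Type) [Field K] (n : ℕ) {i i' : ℕ} (h : i ≤ i') : AP K n i →+* AP K n i' :=
  (rename (Prod.map (id : Fin n → Fin n) (Fin.castLE (by omega)))).toRingHom

lemma inclA_comp_renAA (K : Type) [Field K] (n : ℕ) {i i' : ℕ} (h : i ≤ i') :
    (inclA K n i').comp (renAA K n h) = inclA K n i := by
  ext p
  · simp [inclA, renAA]
  · simp [inclA, renAA]

lemma Pc_eq_comap {K : Type} [Field K] {n : ℕ} (𝔓 : Ideal (DP K n)) {i i' : ℕ} (h : i ≤ i') :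
    Pc i 𝔓 = (Pc i' 𝔓).comap (renAA K n h) := by
  unfold Pc
  rw [Ideal.comap_comap, inclA_comp_renAA]

/-- the canonical local map `B_i → B_{i'}`, `i ≤ i'` -/
def ringBB {K : Type} [Field K] {n : ℕ} (𝔓 : Ideal (DP K n)) [𝔓.IsPrime] {i i' : ℕ}
    (h : i ≤ i') : BL K n i 𝔓 →+* BL K n i' 𝔓 :=
  Localization.localRingHom _ _ (renAA K n h) (Pc_eq_comap 𝔓 h)

/-- the canonical local map `B_i → K{X}_𝔓` -/
def ringBP {K : Type} [Field K] {n : ℕ} (𝔓 : Ideal (DP K n)) [𝔓.IsPrime] (i : ℕ) :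
    BL K n i 𝔓 →+* Localization.AtPrime 𝔓 :=
  Localization.localRingHom _ _ (inclA K n i) rfl

/-- the image in `B_j` of a differential polynomial (of order `≤ j`) -/
def bElem {K : Type} [Field K] {n : ℕ} (𝔓 : Ideal (DP K n)) [𝔓.IsPrime] (j : ℕ)
    (g : DP K n) : BL K n j 𝔓 :=
  algebraMap (AP K n j) (BL K n j 𝔓) (truncA K n j g)

/-- the prolongation ideal `Δ_m = (f_1^{[m-1]},…,f_r^{[m-1]})` in the ring `B_j` -/
def prolong (D : DP K n → DP K n) {r : ℕ} (f : Fin r → DP K n)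
    (𝔓 : Ideal (DP K n)) [𝔓.IsPrime] (m j : ℕ) : Ideal (BL K n j 𝔓) :=
  Ideal.span {x | ∃ (t : Fin r) (s : ℕ) (a : AP K n j),
    s < m ∧ inclA K n j a = D^[s] (f t) ∧ x = algebraMap (AP K n j) (BL K n j 𝔓) a}

/-- `Δ := 𝔓·K{X}_𝔓` -/
def bigDelta {K : Type} [Field K] {n : ℕ} (𝔓 : Ideal (DP K n)) [𝔓.IsPrime] :
    Ideal (Localization.AtPrime 𝔓) :=
  Ideal.map (algebraMap (DP K n) (Localization.AtPrime 𝔓)) 𝔓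

instance {K : Type} [Field K] {n : ℕ} (𝔓 : Ideal (DP K n)) [𝔓.IsPrime] :
    IsDomain (DP K n ⧸ 𝔓) := Ideal.Quotient.isDomain 𝔓

/-- `𝕂 := Frac(K{X}/𝔓)`, the residual field of `𝔓` -/
abbrev KK (K : Type) [Field K] (n : ℕ) (𝔓 : Ideal (DP K n)) [𝔓.IsPrime] : Type :=
  FractionRing (DP K n ⧸ 𝔓)

/-- the canonical map `K{X} → 𝕂` -/
def toKK {K : Type} [Field K] {n : ℕ} (𝔓 : Ideal (DP K n)) [𝔓.IsPrime] :
    DP K n →+* KK K n 𝔓 :=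
  (algebraMap (DP K n ⧸ 𝔓) (KK K n 𝔓)).comp (Ideal.Quotient.mk 𝔓)

/-- the Jacobian matrix of `f_1^{[i-1]},…,f_r^{[i-1]}` with respect to `X^{[i-1+e]}`,
with entries taken in `𝕂` (full row rank over the domain `A_{i-1+e}/(A_{i-1+e}∩𝔓)` is
equivalent to full rank over its fraction field, hence over `𝕂`). -/
def qrJac (D : DP K n → DP K n) {r : ℕ} (f : Fin r → DP K n)
    (𝔓 : Ideal (DP K n)) [𝔓.IsPrime] (e i : ℕ) :
    Matrix (Fin r × Fin i) (Fin n × Fin (i + e)) (KK K n 𝔓) :=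
  fun p q => toKK 𝔓 (pderiv (q.1, (q.2 : ℕ)) (D^[(p.2 : ℕ)] (f p.1)))

/-- the system `f_1,…,f_r` is quasi-regular at `𝔓` -/
def IsQuasiRegularAt (D : DP K n → DP K n) {r : ℕ} (f : Fin r → DP K n)
    (𝔓 : Ideal (DP K n)) [𝔓.IsPrime] (e : ℕ) : Prop :=
  ∀ i : ℕ, 1 ≤ i → (qrJac D f 𝔓 e i).rank = r * i

/-- the entry of the pseudo-Jacobian `𝔍_{k,i}` in block `(p,q)`, row `t := p.2`,
column `j := q.2`: `∂ f_t^{(i-e+1+p)} / ∂ X_j^{(i+1+q)}` -/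
def jEntry (D : DP K n → DP K n) {r : ℕ} (f : Fin r → DP K n) (e i : ℕ) {k : ℕ}
    (p : Fin k × Fin r) (q : Fin k × Fin n) : DP K n :=
  pderiv (q.2, i + 1 + (q.1 : ℕ)) (D^[i + 1 - e + (p.1 : ℕ)] (f p.2))

/-- the pseudo-Jacobian `𝔍_{k,i}` over `𝕂` -/
def Jmat (D : DP K n → DP K n) {r : ℕ} (f : Fin r → DP K n)
    (𝔓 : Ideal (DP K n)) [𝔓.IsPrime] (e k i : ℕ) :
    Matrix (Fin k × Fin r) (Fin k × Fin n) (KK K n 𝔓) :=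
  fun p q => toKK 𝔓 (jEntry D f e i p q)

/-- `μ_{k,i} := kr − rank_𝕂 𝔍_{k,i}` -/
def mu (D : DP K n → DP K n) {r : ℕ} (f : Fin r → DP K n)
    (𝔓 : Ideal (DP K n)) [𝔓.IsPrime] (e k i : ℕ) : ℕ :=
  k * r - (Jmat D f 𝔓 e k i).rank

/-- the pseudo-Jacobian `𝔍_{k,i}` over the ring `B_j / Δ_m` -/
def JmatOver (D : DP K n → DP K n) {r : ℕ} (f : Fin r → DP K n)
    (𝔓 : Ideal (DP K n)) [𝔓.IsPrime] (e k i m j : ℕ) :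
    Matrix (Fin k × Fin r) (Fin k × Fin n) (BL K n j 𝔓 ⧸ prolong D f 𝔓 m j) :=
  fun p q => Ideal.Quotient.mk _ (bElem 𝔓 j (jEntry D f e i p q))

/-- the standing rank hypothesis: for every `k,i` the rank of `𝔍_{k,i}` over the
domain `B_{i+k+s}/Δ_{i-1+e+k+s}` does not depend on `s` and equals its rank over `𝕂` -/
def StandingRank (D : DP K n → DP K n) {r : ℕ} (f : Fin r → DP K n)
    (𝔓 : Ideal (DP K n)) [𝔓.IsPrime] (e : ℕ) : Prop :=
  ∀ k i s : ℕ, 1 ≤ k → e - 1 ≤ i →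
    (JmatOver D f 𝔓 e k i (i - 1 + e + k + s) (i + k + s)).rank = (Jmat D f 𝔓 e k i).rank

/-- the Jacobi number of a matrix of natural numbers -/
def jacobiN {ι κ : Type} [Fintype ι] [Fintype κ] [DecidableEq ι] [DecidableEq κ]
    (M : ι → κ → ℕ) : ℕ :=
  Finset.univ.sup fun τ : {τ : ι → κ // Function.Injective τ} => ∑ i, M i (τ.1 i)

/-- the Jacobi number of a matrix with entries in `ℕ₀ ∪ {−∞}` -/
def jacobiE {ι κ : Type} [Fintype ι] [Fintype κ] [DecidableEq ι] [DecidableEq κ]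
    (M : ι → κ → WithBot ℕ) : WithBot ℕ :=
  Finset.univ.sup fun τ : {τ : ι → κ // Function.Injective τ} => ∑ i, M i (τ.1 i)

/-- the (finite) transcendence degree of `E` over `F` equals `d` -/
def HasTrdeg (F E : Type) [CommRing F] [CommRing E] [Algebra F E] (d : ℕ) : Prop :=
  ∃ s : Finset E, IsTranscendenceBasis F (fun x : {x : E // x ∈ s} => x.1) ∧ s.card = d

end DAE

namespace DAE
open MvPolynomial

section gen
variable {K E σ : Type} [Field K] [Field E] [Algebra K E]

/-- differential of `g` evaluated through `π` -/
def dd (π : MvPolynomial σ K →ₐ[K] E) (g : MvPolynomial σ K) : σ →₀ E :=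
  Finsupp.mapRange π (map_zero π)
    (mkDerivation K (fun i => Finsupp.single i (1 : MvPolynomial σ K)) g)

lemma dd_apply (π : MvPolynomial σ K →ₐ[K] E) (g : MvPolynomial σ K) (v : σ) :
    dd π g v = π (pderiv v g) := by
  rw [dd, Finsupp.mapRange_apply, ← KaehlerDifferential.mvPolynomialBasis_repr_D,
    KaehlerDifferential.mvPolynomialBasis_repr_apply]

lemma dd_add (π : MvPolynomial σ K →ₐ[K] E) (g h : MvPolynomial σ K) :
    dd π (g + h) = dd π g + dd π h := by
  ext v; simp [dd_apply]

lemma dd_mul (π : MvPolynomial σ K →ₐ[K] E) (g h : MvPolynomial σ K) :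
    dd π (g * h) = π g • dd π h + π h • dd π g := by
  ext v; simp [dd_apply, Derivation.leibniz]

lemma dd_C (π : MvPolynomial σ K →ₐ[K] E) (a : K) : dd π (C a) = 0 := by
  ext v; simp [dd_apply]

lemma dd_X (π : MvPolynomial σ K →ₐ[K] E) (v : σ) : dd π (X v) = Finsupp.single v 1 := by
  classical
  ext u; rw [dd_apply, pderiv_X, Finsupp.single_apply, Pi.single_apply]
  split_ifs <;> simp_all

open scoped Polynomial in
lemma taylor (π : MvPolynomial σ K →ₐ[K] E) (x : σ → E[X]) (w : σ → E) (j : ℕ) (hj : 1 ≤ j)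
    (hx : ∀ v, (x v).coeff 0 = π (MvPolynomial.X v)) (g : MvPolynomial σ K) :
    (Polynomial.X : E[X]) ∣ aeval x g - Polynomial.C (π g) ∧
    (Polynomial.X : E[X]) ^ (j + 1) ∣ aeval (fun v => x v + Polynomial.X ^ j * Polynomial.C (w v)) g - aeval x g
      - Polynomial.X ^ j * Polynomial.C (Finsupp.linearCombination E w (dd π g)) := by
  induction g using MvPolynomial.induction_on with
  | C a =>
    rw [dd_C]
    simp [← MvPolynomial.algebraMap_eq, Polynomial.algebraMap_eq, IsScalarTower.algebraMap_apply K E E[X]]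
  | add p q hp hq =>
    rw [dd_add]
    obtain ⟨⟨a, ha⟩, b, hb⟩ := hp
    obtain ⟨⟨a', ha'⟩, b', hb'⟩ := hq
    refine ⟨⟨a + a', ?_⟩, b + b', ?_⟩
    · simp only [map_add]; linear_combination ha + ha'
    · simp only [map_add]; linear_combination hb + hb'
  | mul_X p v hp =>
    rw [dd_mul, dd_X]
    obtain ⟨⟨a, ha⟩, b, hb⟩ := hp
    obtain ⟨c, hc⟩ : (Polynomial.X : E[X]) ∣ x v - Polynomial.C (π (MvPolynomial.X v)) := by
      rw [Polynomial.X_dvd_iff]; simp [hx]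
    obtain ⟨k, rfl⟩ : ∃ k, j = k + 1 := ⟨j - 1, by omega⟩
    refine ⟨?_, ?_⟩
    · refine ⟨a * x v + Polynomial.C (π p) * c, ?_⟩
      simp only [map_mul, aeval_X]
      linear_combination x v * ha + Polynomial.C (π p) * hc
    · refine ⟨b * (x v + Polynomial.X ^ (k+1) * Polynomial.C (w v)) + a * Polynomial.C (w v) + Polynomial.X ^ k * Polynomial.C (Finsupp.linearCombination E w (dd π p)) * Polynomial.C (w v)
        + Polynomial.C (Finsupp.linearCombination E w (dd π p)) * c, ?_⟩
      simp only [map_mul, aeval_X, map_add, map_smul, Finsupp.linearCombination_single, smul_eq_mul, one_mul]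
      linear_combination (x v + Polynomial.X ^ (k+1) * Polynomial.C (w v)) * hb + Polynomial.X ^ (k+1) * Polynomial.C (w v) * ha
        + Polynomial.X ^ (k+1) * Polynomial.C (Finsupp.linearCombination E w (dd π p)) * hc

open scoped Polynomial in
lemma curve {ι : Type} (π : MvPolynomial σ K →ₐ[K] E) (h : ι → MvPolynomial σ K)
    (hh : ∀ i, π (h i) = 0)
    (hsurj : ∀ b : ι → E, ∃ w : σ → E, ∀ i, Finsupp.linearCombination E w (dd π (h i)) = b i)
    (u : σ → E) (hu : ∀ i, Finsupp.linearCombination E u (dd π (h i)) = 0) (k : ℕ) :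
    ∃ x : σ → E[X], (∀ v, (x v).coeff 0 = π (MvPolynomial.X v)) ∧
      (∀ g, Polynomial.X ^ 2 ∣ aeval x g - Polynomial.C (π g) - Polynomial.X * Polynomial.C (Finsupp.linearCombination E u (dd π g))) ∧
      ∀ i, Polynomial.X ^ (k + 2) ∣ aeval x (h i) := by
  induction k with
  | zero =>
    have key : ∀ g : MvPolynomial σ K, aeval (fun v => (Polynomial.C (π (MvPolynomial.X v)) : E[X])) g = Polynomial.C (π g) := by
      intro g
      have : (aeval (fun v => (Polynomial.C (π (MvPolynomial.X v)) : E[X])) : MvPolynomial σ K →ₐ[K] E[X])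
          = (IsScalarTower.toAlgHom K E E[X]).comp π := by
        ext v; simp [Polynomial.algebraMap_eq]
      rw [this]; simp [Polynomial.algebraMap_eq]
    have main : ∀ g : MvPolynomial σ K, (Polynomial.X : E[X]) ^ 2 ∣ aeval (fun v => Polynomial.C (π (MvPolynomial.X v)) + Polynomial.X ^ 1 * Polynomial.C (u v)) g - Polynomial.C (π g) - Polynomial.X * Polynomial.C (Finsupp.linearCombination E u (dd π g)) := by
      intro g
      have := (taylor π (fun v => (Polynomial.C (π (MvPolynomial.X v)) : E[X])) u 1 le_rfl (by simp) g).2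
      rw [key] at this
      simpa using this
    refine ⟨fun v => Polynomial.C (π (MvPolynomial.X v)) + Polynomial.X ^ 1 * Polynomial.C (u v), by simp, main, fun i => ?_⟩
    have := main (h i)
    rw [hh, hu] at this
    simpa using this
  | succ k ih =>
    obtain ⟨x, hx0, hx1, hx2⟩ := ih
    choose y hy using hx2
    obtain ⟨w, hw⟩ := hsurj (fun i => - (y i).coeff 0)
    have T := fun g => (taylor π x w (k+2) (by omega) hx0 g).2
    refine ⟨fun v => x v + Polynomial.X ^ (k+2) * Polynomial.C (w v), ?_, ?_, ?_⟩
    · intro v; simp [hx0]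
    · intro g
      obtain ⟨a, ha⟩ := hx1 g
      obtain ⟨b, hb⟩ := T g
      refine ⟨a + Polynomial.X ^ (k+1) * b + Polynomial.X ^ k * Polynomial.C (Finsupp.linearCombination E w (dd π g)), ?_⟩
      linear_combination ha + hb
    · intro i
      obtain ⟨b, hb⟩ := T (h i)
      obtain ⟨c, hc⟩ : Polynomial.X ∣ y i - Polynomial.C ((y i).coeff 0) := by
        rw [Polynomial.X_dvd_iff]; simp
      rw [hw, map_neg, hy] at hb
      refine ⟨b + c, ?_⟩
      linear_combination hb + Polynomial.X ^ (k+2) * hc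

open scoped Polynomial in
lemma jacobian {ι : Type} (π : MvPolynomial σ K →ₐ[K] E) (h : ι → MvPolynomial σ K)
    (hh : ∀ i, π (h i) = 0)
    (hsurj : ∀ b : ι → E, ∃ w : σ → E, ∀ i, Finsupp.linearCombination E w (dd π (h i)) = b i)
    (s g : MvPolynomial σ K) (k : ℕ) (hs : π s ≠ 0) (hg : π g = 0)
    (hmem : s * g ^ k ∈ Ideal.span (Set.range h)) :
    dd π g ∈ Submodule.span E (Set.range fun i => dd π (h i)) := by
  by_contra hcon
  obtain ⟨φ, hφ, hφ'⟩ := Submodule.exists_dual_map_eq_bot_of_notMem hcon inferInstance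
  obtain ⟨u, rfl⟩ : ∃ u : σ → E, φ = Finsupp.linearCombination E u :=
    ⟨fun v => φ (Finsupp.single v 1), by ext v; simp⟩
  have hu : ∀ i, Finsupp.linearCombination E u (dd π (h i)) = 0 := by
    intro i
    have : Finsupp.linearCombination E u (dd π (h i)) ∈
      (Submodule.span E (Set.range fun i => dd π (h i))).map (Finsupp.linearCombination E u) :=
      Submodule.mem_map_of_mem (Submodule.subset_span ⟨i, rfl⟩)
    rw [hφ'] at this
    simpa using this
  obtain ⟨x, hx0, hx1, hx2⟩ := curve π h hh hsurj u hu k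
  have hd : (Polynomial.X : E[X]) ^ (k+2) ∣ aeval x (s * g ^ k) := by
    have : s * g ^ k ∈ (Ideal.span {(Polynomial.X : E[X]) ^ (k+2)}).comap (aeval x).toRingHom := by
      refine (Ideal.span_le.2 ?_) hmem
      rintro _ ⟨i, rfl⟩
      exact Ideal.mem_span_singleton.2 (hx2 i)
    exact Ideal.mem_span_singleton.1 this
  obtain ⟨a, ha⟩ := hx1 g
  obtain ⟨b, hb⟩ := hx1 s
  have hp : Prime (Polynomial.X : E[X]) := Polynomial.prime_X
  set q : E[X] := Polynomial.C (Finsupp.linearCombination E u (dd π g)) + Polynomial.X * a with hq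
  have hgx : aeval x g = Polynomial.X * q := by
    rw [hg] at ha
    simp only [map_zero] at ha
    linear_combination ha
  have hqX : ¬ Polynomial.X ∣ q := by
    rw [Polynomial.X_dvd_iff]; simpa [hq] using hφ
  have hsX : ¬ Polynomial.X ∣ aeval x s := by
    rw [show aeval x s = Polynomial.C (π s) + Polynomial.X * (Polynomial.C (Finsupp.linearCombination E u (dd π s)) + Polynomial.X * b) by
      linear_combination hb, Polynomial.X_dvd_iff]
    simpa using hs
  rw [map_mul, map_pow, hgx, mul_pow, show aeval x s * (Polynomial.X ^ k * q ^ k) = Polynomial.X ^ k * (aeval x s * q ^ k) by ring,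
    pow_add] at hd
  have hd' := (mul_dvd_mul_iff_left (pow_ne_zero k hp.ne_zero)).1 hd
  have := (dvd_pow_self Polynomial.X two_ne_zero).trans hd'
  rcases hp.dvd_or_dvd this with h1 | h1
  · exact hsX h1
  · exact hqX (hp.dvd_of_dvd_pow h1)

end gen
end DAE

namespace DAE
open MvPolynomial

section gen2
variable {K E σ : Type} [Field K] [Field E] [Algebra K E]

lemma coeff_pder {ι : Type} (i : ι) (p : MvPolynomial ι K) (m : ι →₀ ℕ) :
    coeff m (pderiv i p) = coeff (m + Finsupp.single i 1) p * ((m i : K) + 1) := by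
  classical
  induction p using MvPolynomial.induction_on' with
  | monomial s a =>
    rw [pderiv_monomial, coeff_monomial, coeff_monomial]
    by_cases h : s = m + Finsupp.single i 1
    · subst h; simp
    · rw [if_neg h, zero_mul]
      split_ifs with h2
      · have : s i = 0 := by
          by_contra h0
          apply h
          rw [← h2]
          ext j
          by_cases hj : j = i
          · subst hj; simp; omega
          · simp [Finsupp.single_apply, Ne.symm hj]
        simp [this]
      · rfl
  | add p q hp hq => simp [hp, hq, add_mul]

lemma eq_zero_of_pder {ι : Type} [CharZero K] (x : ι → E)
    (H : ∀ p : MvPolynomial ι K, aeval x p = 0 → ∀ i, aeval x (pderiv i p) = 0) :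
    AlgebraicIndependent K x := by
  classical
  rw [algebraicIndependent_iff]
  have main : ∀ N : ℕ, ∀ p : MvPolynomial ι K, (∀ m, coeff m p ≠ 0 → m.degree < N) →
      aeval x p = 0 → p = 0 := by
    intro N
    induction N with
    | zero =>
      intro p hp _
      ext m
      by_contra h
      exact absurd (hp m h) (by omega)
    | succ N ih =>
      intro p hp hp0
      have hd : ∀ i, pderiv i p = 0 := by
        intro i
        apply ih _ _ (H p hp0 i)
        intro m hm
        rw [coeff_pder] at hm
        have := hp _ (left_ne_zero_of_mul hm)
        simp at this
        omega
      have hC : p = C (coeff 0 p) := by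
        ext m
        rw [coeff_C]
        split_ifs with h
        · rw [h]
        · obtain ⟨i, hi⟩ : ∃ i, m i ≠ 0 := by
            by_contra hcon
            push Not at hcon
            exact h (by ext i; simp [hcon])
          have h1 := congrArg (coeff (m - Finsupp.single i 1)) (hd i)
          rw [coeff_pder, coeff_zero, show m - Finsupp.single i 1 + Finsupp.single i 1 = m by
            ext j
            by_cases hj : j = i
            · subst hj; simp; omega
            · simp [Finsupp.single_apply, Ne.symm hj]] at h1
          refine (mul_eq_zero.1 h1).resolve_right ?_
          exact Nat.cast_add_one_ne_zero _
      rw [hC] at hp0 ⊢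
      rw [← algebraMap_eq, AlgHom.commutes] at hp0
      rw [(map_eq_zero _).1 hp0, map_zero]
  intro p hp
  refine main (p.support.sup Finsupp.degree + 1) p ?_ hp
  intro m hm
  exact Nat.lt_succ_of_le (Finset.le_sup (f := Finsupp.degree) (mem_support_iff.2 hm))

lemma dd_rename {ι : Type} (π : MvPolynomial σ K →ₐ[K] E) (κ : ι → σ) (p : MvPolynomial ι K) :
    dd π (rename κ p) = Finsupp.mapDomain κ (dd (π.comp (rename κ)) p) := by
  induction p using MvPolynomial.induction_on with
  | C a => rw [rename_C, dd_C, dd_C]; simp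
  | add p q hp hq => simp [dd_add, hp, hq, Finsupp.mapDomain_add]
  | mul_X p v hp =>
    simp [dd_mul, hp, Finsupp.mapDomain_add, Finsupp.mapDomain_smul, dd_X]

/-- conormal space -/
def WW (π : MvPolynomial σ K →ₐ[K] E) : Submodule E (σ →₀ E) :=
  Submodule.span E (dd π '' {g | π g = 0})

lemma algInd_of_linInd [CharZero K] {ι : Type} (π : MvPolynomial σ K →ₐ[K] E) (κ : ι → σ)
    (h : LinearIndependent E (fun i => (WW π).mkQ (Finsupp.single (κ i) 1))) :
    AlgebraicIndependent K (fun i => π (X (κ i))) := by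
  apply eq_zero_of_pder
  have hae : ∀ p : MvPolynomial ι K, aeval (fun i => π (X (κ i))) p = π (rename κ p) := by
    intro p
    have : aeval (fun i => π (X (κ i))) = π.comp (rename κ) := by ext i; simp
    rw [this]; rfl
  intro p hp i
  rw [hae] at hp ⊢
  have h1 : dd π (rename κ p) ∈ WW π := Submodule.subset_span ⟨_, hp, rfl⟩
  rw [dd_rename] at h1
  have h2 : Finsupp.linearCombination E (fun i => (WW π).mkQ (Finsupp.single (κ i) 1))
      (dd (π.comp (rename κ)) p) = 0 := by
    have : Finsupp.linearCombination E (fun i => (WW π).mkQ (Finsupp.single (κ i) 1))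
       = (WW π).mkQ ∘ₗ (Finsupp.lmapDomain E E κ) := by
      ext i; simp
    rw [this]
    simpa using h1
  have h3 := (linearIndependent_iff.1 h) _ h2
  have h4 := DFunLike.congr_fun h3 i
  rw [dd_apply] at h4
  exact h4

open scoped IntermediateField.algebraAdjoinAdjoin in
lemma linInd_D_basis [CharZero K] (t : Set E) (ht : IsTranscendenceBasis K ((↑) : t → E)) :
    LinearIndependent E (fun i : t => KaehlerDifferential.D K E (i : E)) := by
  have : CharZero E := charZero_of_injective_algebraMap (algebraMap K E).injective
  let : Algebra (MvPolynomial t K) E := (aeval ((↑) : t → E)).toAlgebra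
  let : Algebra (MvPolynomial t K) (Algebra.adjoin K (Set.range ((↑) : t → E))) :=
    (ht.1.aevalEquiv : MvPolynomial t K →+* _).toAlgebra
  have : IsScalarTower K (MvPolynomial t K) E := IsScalarTower.of_algHom (aeval ((↑) : t → E))
  have : IsScalarTower (MvPolynomial t K) (Algebra.adjoin K (Set.range ((↑) : t → E))) E :=
    .of_algebraMap_eq fun p => by
      change aeval ((↑) : t → E) p = ((ht.1.aevalEquiv p : Algebra.adjoin K (Set.range ((↑) : t → E))) : E)
      simp
  have : Algebra.FormallyEtale (MvPolynomial t K) (Algebra.adjoin K (Set.range ((↑) : t → E))) :=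
    .of_equiv (A := MvPolynomial t K) (AlgEquiv.ofRingEquiv (f := ht.1.aevalEquiv.toRingEquiv) (fun _ => rfl))
  have := ht.isAlgebraic_field
  have : Algebra.FormallyEtale (Algebra.adjoin K (Set.range ((↑) : t → E)))
      (IntermediateField.adjoin K (Set.range ((↑) : t → E))) := .of_isLocalization (nonZeroDivisors _)
  have : Algebra.FormallyEtale (IntermediateField.adjoin K (Set.range ((↑) : t → E))) E :=
    Algebra.FormallyEtale.of_isSeparable _ _
  have : Algebra.FormallyEtale (Algebra.adjoin K (Set.range ((↑) : t → E))) E :=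
    .comp _ (IntermediateField.adjoin K (Set.range ((↑) : t → E))) _
  have : Algebra.FormallyEtale (MvPolynomial t K) E :=
    .comp _ (Algebra.adjoin K (Set.range ((↑) : t → E))) _
  let b := (((KaehlerDifferential.mvPolynomialBasis K t).baseChange E).map
    (KaehlerDifferential.tensorKaehlerEquivOfFormallyEtale K (MvPolynomial t K) E))
  have hb : ∀ i : t, b i = KaehlerDifferential.D K E (i : E) := by
    intro i
    have : algebraMap (MvPolynomial t K) E (X i) = i := by
      change aeval ((↑) : t → E) (X i) = _
      simp
    simp [b, this]
  have := b.linearIndependent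
  rwa [show (b : t → _) = _ from funext hb] at this

lemma linInd_D [CharZero K] {ι : Type} (x : ι → E) (hx : AlgebraicIndependent K x) :
    LinearIndependent E (fun i => KaehlerDifferential.D K E (x i)) := by
  obtain ⟨t, hst, ht⟩ := exists_isTranscendenceBasis_superset (AlgebraicIndependent.coe_range hx)
  have := linInd_D_basis t ht
  exact this.comp (fun i => (⟨x i, hst ⟨i, rfl⟩⟩ : t)) (fun i j hij => hx.injective (by simpa using hij))

lemma linInd_of_algInd [CharZero K] {ι : Type} (π : MvPolynomial σ K →ₐ[K] E) (κ : ι → σ)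
    (h : AlgebraicIndependent K (fun i => π (X (κ i)))) :
    LinearIndependent E (fun i => (WW π).mkQ (Finsupp.single (κ i) 1)) := by
  let ψ : (σ →₀ E) →ₗ[E] Ω[E⁄K] := Finsupp.linearCombination E
    (fun v => KaehlerDifferential.D K E (π (X v)))
  have hψ : ∀ g, ψ (dd π g) = KaehlerDifferential.D K E (π g) := by
    intro g
    induction g using MvPolynomial.induction_on with
    | C a => rw [dd_C, ← algebraMap_eq, AlgHom.commutes]; simp
    | add p q hp hq => simp [dd_add, hp, hq]
    | mul_X p v hp => rw [dd_mul, map_add, map_smul, map_smul, hp, dd_X]; simp [ψ]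
  have hW : WW π ≤ LinearMap.ker ψ := by
    rw [WW, Submodule.span_le]
    rintro _ ⟨g, hg, rfl⟩
    have hg' : π g = 0 := hg
    simp [hψ, hg']
  apply LinearIndependent.of_comp ((WW π).liftQ ψ hW)
  have h5 : (⇑((WW π).liftQ ψ hW) ∘ fun i => (WW π).mkQ (Finsupp.single (κ i) 1))
      = fun i => KaehlerDifferential.D K E (π (X (κ i))) := by
    funext i
    simp [ψ]
  rw [h5]
  exact linInd_D _ h

lemma hasTrdeg_unique {F : Type} [Field F] [Algebra K F] {a b : ℕ} (ha : HasTrdeg K F a)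
    (hb : HasTrdeg K F b) : a = b := by
  obtain ⟨s, hs, rfl⟩ := ha
  obtain ⟨t, ht, rfl⟩ := hb
  have := hs.cardinalMk_eq ht
  simpa using this

lemma trdeg_dim [CharZero K] {ι F : Type} [Finite ι] [Field F] [Algebra K F]
    (π : MvPolynomial σ K →ₐ[K] E) (τ : ι → σ) (j : F →ₐ[K] E) (y : ι → F)
    (hy : ∀ i, j (y i) = π (X (τ i))) [Algebra.IsAlgebraic (Algebra.adjoin K (Set.range y)) F] :
    HasTrdeg K F (Module.finrank E
      (Submodule.span E (Set.range fun i => (WW π).mkQ (Finsupp.single (τ i) 1)))) := by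
  classical
  obtain ⟨t, hts, ht⟩ := exists_isTranscendenceBasis_subset (R := K) (Set.range y)
  have hfin : t.Finite := (Set.finite_range y).subset hts
  refine ⟨hfin.toFinset, ?_, ?_⟩
  · have e : {x : F // x ∈ hfin.toFinset} ≃ t := Equiv.subtypeEquivRight (by simp)
    have := ht.comp_equiv (Equiv.subtypeEquivRight (p := fun x => x ∈ hfin.toFinset) (q := fun x => x ∈ t) (by simp))
    exact this
  set N := Submodule.span E (Set.range fun i => (WW π).mkQ (Finsupp.single (τ i) 1)) with hN
  have : Module.Finite E N := Module.Finite.span_of_finite E (Set.finite_range _)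
  have := hfin.fintype
  have hcard : hfin.toFinset.card = Fintype.card t := by
    rw [Set.Finite.card_toFinset]
  rw [hcard]
  apply le_antisymm
  · choose c hc using hts
    have h1 : AlgebraicIndependent K (fun a : t => π (X (τ (c a.2)))) := by
      have := ht.1.map' (f := j) j.injective
      convert this using 1
      ext a
      simp [← hy, hc]
    have h2 := linInd_of_algInd π _ h1
    have h3 : LinearIndependent E (fun a : t => (⟨(WW π).mkQ (Finsupp.single (τ (c a.2)) 1),
      Submodule.subset_span ⟨c a.2, rfl⟩⟩ : N)) := LinearIndependent.of_comp N.subtype h2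
    exact h3.fintype_card_le_finrank
  · obtain ⟨f, hf1, -, hf3⟩ := Submodule.exists_fun_fin_finrank_span_eq E
      (Set.range fun i => (WW π).mkQ (Finsupp.single (τ i) 1))
    choose c hc using hf1
    have h1 : LinearIndependent E (fun i => (WW π).mkQ (Finsupp.single (τ (c i)) 1)) := by
      have h6 : (fun i => (WW π).mkQ (Finsupp.single (τ (c i)) 1)) = f := funext hc
      rw [h6]
      exact hf3
    have h2 := algInd_of_linInd π _ h1
    have h3 : AlgebraicIndependent K (fun i => y (c i)) := by
      have h4 : AlgebraicIndependent K (j ∘ fun i => y (c i)) := by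
        have h6 : (j ∘ fun i => y (c i)) = fun i => π (X (τ (c i))) := by
          funext i; exact hy _
        rw [h6]
        exact h2
      exact h4.of_comp j
    have h5 := h3.lift_cardinalMk_le_trdeg
    rw [← ht.cardinalMk_eq_trdeg] at h5
    simp only [Cardinal.mk_fintype, Cardinal.lift_natCast, Nat.cast_le] at h5
    rw [Fintype.card_fin] at h5
    exact h5

end gen2
end DAE

namespace DAE

section lin
variable {E : Type} [Field E] {n : ℕ}

lemma finrank_map_inf {M M' : Type} [AddCommGroup M] [Module E M] [AddCommGroup M'] [Module E M']
    (P : Submodule E M) [Module.Finite E P] (f : M →ₗ[E] M') (Q : Submodule E M)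
    (hQ : Q ≤ P) (hQ' : ∀ m ∈ P, m ∈ Q ↔ f m = 0) :
    Module.finrank E (P.map f) + Module.finrank E Q = Module.finrank E P := by
  have h := LinearMap.finrank_range_add_finrank_ker (f.domRestrict P)
  have h1 : LinearMap.range (f.domRestrict P) = P.map f := by
    rw [LinearMap.domRestrict, LinearMap.range_comp, Submodule.range_subtype]
  have h2 : LinearMap.ker (f.domRestrict P) = Q.comap P.subtype := by
    ext ⟨m, hm⟩
    simp [hQ' m hm]
  rw [h1, h2, (Submodule.comapSubtypeEquivOfLe hQ).finrank_eq] at h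
  exact h

/-- order `< k` -/
def FF (E : Type) [Field E] (n k : ℕ) : Submodule E (Fin n × ℕ →₀ E) :=
  Finsupp.supported E E {v | v.2 < k}

lemma mem_FF {k : ℕ} {m : Fin n × ℕ →₀ E} :
    m ∈ FF E n k ↔ ∀ j l, k ≤ l → m (j, l) = 0 := by
  rw [FF, Finsupp.mem_supported']
  constructor
  · intro h j l hl
    exact h (j, l) (by simpa using hl)
  · rintro h ⟨j, l⟩ hl
    exact h j l (by simpa using hl)

lemma FF_eq_span (k : ℕ) : FF E n k = Submodule.span E
    (Set.range fun v : Fin n × Fin k => Finsupp.single ((v.1, (v.2 : ℕ)) : Fin n × ℕ) (1 : E)) := by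
  rw [FF, Finsupp.supported_eq_span_single]
  congr 1
  ext m
  constructor
  · rintro ⟨⟨j, l⟩, hl, rfl⟩
    exact ⟨(j, ⟨l, hl⟩), rfl⟩
  · rintro ⟨⟨j, l⟩, rfl⟩
    exact ⟨(j, l), l.2, rfl⟩

instance (k : ℕ) : Module.Finite E (FF E n k) := by
  rw [FF_eq_span]; exact Module.Finite.span_of_finite E (Set.finite_range _)

lemma finrank_FF (k : ℕ) : Module.finrank E (FF E n k) = n * k := by
  rw [FF_eq_span, finrank_span_eq_card]
  · simp
  · have h := (Finsupp.basisSingleOne (R := E) (ι := Fin n × ℕ)).linearIndependent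
    have := h.comp (fun v : Fin n × Fin k => ((v.1, (v.2 : ℕ)) : Fin n × ℕ)) (by
      rintro ⟨a, b⟩ ⟨c, d⟩ h
      simp only [Prod.mk.injEq] at h
      ext
      · simp [h.1]
      · simp [h.2])
    simpa [Function.comp_def] using this

/-- coefficient of order `i` -/
def lead (E : Type) [Field E] (n i : ℕ) : (Fin n × ℕ →₀ E) →ₗ[E] (Fin n → E) :=
  LinearMap.pi fun j => Finsupp.lapply (j, i)

lemma lead_apply (i : ℕ) (m : Fin n × ℕ →₀ E) (j : Fin n) : lead E n i m j = m (j, i) := rfl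

lemma mem_FF_of_lead {i : ℕ} {m : Fin n × ℕ →₀ E} (hm : m ∈ FF E n (i + 1)) :
    m ∈ FF E n i ↔ lead E n i m = 0 := by
  rw [mem_FF] at *
  constructor
  · intro h
    ext j
    exact h j i le_rfl
  · intro h j l hl
    rcases hl.eq_or_lt with rfl | hl
    · exact congrFun h j
    · exact hm j l hl

/-- the semilinear prolongation operator -/
structure IsT (n : ℕ) (dE : E → E) (T : (Fin n × ℕ →₀ E) → (Fin n × ℕ →₀ E)) : Prop where
  d0 : dE 0 = 0
  add : ∀ m m', T (m + m') = T m + T m'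
  smul : ∀ (a : E) m, T (a • m) = dE a • m + a • T m
  coeff0 : ∀ m j, T m (j, 0) = dE (m (j, 0))
  coeff1 : ∀ m j l, T m (j, l + 1) = dE (m (j, l + 1)) + m (j, l)

variable {dE : E → E} {T : (Fin n × ℕ →₀ E) → (Fin n × ℕ →₀ E)}

lemma IsT.zero (hT : IsT n dE T) : T 0 = 0 := by
  have := hT.add 0 0
  simpa using this

lemma IsT.lead (hT : IsT n dE T) {i : ℕ} {m : Fin n × ℕ →₀ E} (hm : m ∈ FF E n (i + 1)) :
    lead E n (i + 1) (T m) = lead E n i m := by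
  ext j
  rw [lead_apply, lead_apply, hT.coeff1, mem_FF.1 hm j (i+1) le_rfl, hT.d0, zero_add]

lemma IsT.mem_FF (hT : IsT n dE T) {k : ℕ} {m : Fin n × ℕ →₀ E} (hm : m ∈ FF E n k) :
    T m ∈ FF E n (k + 1) := by
  rw [DAE.mem_FF] at *
  intro j l hl
  obtain ⟨l, rfl⟩ : ∃ l', l = l' + 1 := ⟨l - 1, by omega⟩
  rw [hT.coeff1, hm _ _ (by omega), hm _ _ (by omega), hT.d0, zero_add]

/-- successive prolongations -/
def ZZ (hT : IsT n dE T) (Z0 : Submodule E (Fin n × ℕ →₀ E)) : ℕ → Submodule E (Fin n × ℕ →₀ E)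
  | 0 => Z0
  | j + 1 =>
    { carrier := {m | ∃ z ∈ ZZ hT Z0 j, ∃ z' ∈ ZZ hT Z0 j, m = z + T z'}
      add_mem' := by
        rintro _ _ ⟨a, ha, b, hb, rfl⟩ ⟨c, hc, d, hd, rfl⟩
        refine ⟨a + c, add_mem ha hc, b + d, add_mem hb hd, ?_⟩
        rw [hT.add]; abel
      zero_mem' := ⟨0, zero_mem _, 0, zero_mem _, by rw [hT.zero, add_zero]⟩
      smul_mem' := by
        rintro c _ ⟨a, ha, b, hb, rfl⟩
        refine ⟨c • a - dE c • b, sub_mem (Submodule.smul_mem _ _ ha) (Submodule.smul_mem _ _ hb),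
          c • b, Submodule.smul_mem _ _ hb, ?_⟩
        rw [hT.smul, smul_add]; abel }

lemma mem_ZZ_succ (hT : IsT n dE T) (Z0 : Submodule E (Fin n × ℕ →₀ E)) (j : ℕ)
    (m : Fin n × ℕ →₀ E) :
    m ∈ ZZ hT Z0 (j+1) ↔ ∃ z ∈ ZZ hT Z0 j, ∃ z' ∈ ZZ hT Z0 j, m = z + T z' := Iff.rfl

lemma ZZ_le_succ (hT : IsT n dE T) (Z0 : Submodule E (Fin n × ℕ →₀ E)) (j : ℕ) :
    ZZ hT Z0 j ≤ ZZ hT Z0 (j+1) := fun m hm =>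
  (mem_ZZ_succ ..).2 ⟨m, hm, 0, zero_mem _, by rw [hT.zero, add_zero]⟩

lemma ZZ_mono (hT : IsT n dE T) (Z0 : Submodule E (Fin n × ℕ →₀ E)) : Monotone (ZZ hT Z0) :=
  monotone_nat_of_le_succ (ZZ_le_succ hT Z0)

lemma T_mem_ZZ (hT : IsT n dE T) (Z0 : Submodule E (Fin n × ℕ →₀ E)) (j : ℕ)
    {m : Fin n × ℕ →₀ E} (hm : m ∈ ZZ hT Z0 j) : T m ∈ ZZ hT Z0 (j+1) :=
  (mem_ZZ_succ ..).2 ⟨0, zero_mem _, m, hm, by rw [zero_add]⟩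

lemma ZZ_le (hT : IsT n dE T) (W : Submodule E (Fin n × ℕ →₀ E)) (hW : ∀ m ∈ W, T m ∈ W) (e j : ℕ) :
    ZZ hT (W ⊓ FF E n (e+1)) j ≤ W ⊓ FF E n (e + 1 + j) := by
  induction j with
  | zero => exact le_rfl
  | succ j ih =>
    intro m hm
    obtain ⟨z, hz, z', hz', rfl⟩ := (mem_ZZ_succ ..).1 hm
    have h1 := ih hz
    have h2 := ih hz'
    refine ⟨add_mem h1.1 (hW _ h2.1), add_mem ?_ (hT.mem_FF h2.2)⟩
    have := h1.2
    exact mem_FF.2 fun a l hl => mem_FF.1 this a l (by omega)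

lemma ZZ_drop (hT : IsT n dE T) (W : Submodule E (Fin n × ℕ →₀ E)) (hW : ∀ m ∈ W, T m ∈ W) (e j : ℕ)
    {m : Fin n × ℕ →₀ E} (hm : m ∈ ZZ hT (W ⊓ FF E n (e+1)) (j+1)) (hm' : m ∈ FF E n (e+1+j)) :
    m ∈ ZZ hT (W ⊓ FF E n (e+1)) j := by
  induction j generalizing m with
  | zero => exact ⟨(ZZ_le hT W hW e _ hm).1, hm'⟩
  | succ j ih =>
    obtain ⟨z, hz, z', hz', rfl⟩ := (mem_ZZ_succ ..).1 hm
    refine add_mem hz (T_mem_ZZ _ _ _ (ih hz' ?_))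
    have h1 := (ZZ_le hT W hW e _ hz).2
    have h2 : z' ∈ FF E n (e + 1 + j + 1) := (ZZ_le hT W hW e _ hz').2
    have h3 : T z' ∈ FF E n (e + 1 + (j + 1)) := by
      have := sub_mem hm' h1
      simpa using this
    rw [mem_FF_of_lead h2, ← hT.lead h2]
    ext a
    exact mem_FF.1 h3 a _ (by omega)

lemma ZZ_eq (hT : IsT n dE T) (W : Submodule E (Fin n × ℕ →₀ E)) (hW : ∀ m ∈ W, T m ∈ W) (e : ℕ)
    (hcov : ∀ m ∈ W, ∃ j, m ∈ ZZ hT (W ⊓ FF E n (e+1)) j) (j : ℕ) :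
    ZZ hT (W ⊓ FF E n (e+1)) j = W ⊓ FF E n (e+1+j) := by
  refine le_antisymm (ZZ_le hT W hW e j) ?_
  rintro m ⟨hm, hm'⟩
  obtain ⟨k, hk⟩ := hcov m hm
  have hk' : m ∈ ZZ hT (W ⊓ FF E n (e+1)) (j + k) := ZZ_mono hT _ (by omega) hk
  clear hk
  induction k with
  | zero => exact hk'
  | succ k ih =>
    apply ih
    refine ZZ_drop hT W hW e _ hk' ?_
    exact mem_FF.2 fun a l hl => mem_FF.1 hm' a l (by omega)

lemma map_lead (hT : IsT n dE T) (W : Submodule E (Fin n × ℕ →₀ E)) (hW : ∀ m ∈ W, T m ∈ W) (e : ℕ)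
    (hcov : ∀ m ∈ W, ∃ j, m ∈ ZZ hT (W ⊓ FF E n (e+1)) j) (j : ℕ) :
    (W ⊓ FF E n (e+1+j)).map (lead E n (e + j)) = (W ⊓ FF E n (e+1)).map (lead E n e) := by
  induction j with
  | zero => rfl
  | succ j ih =>
    rw [← ih]
    have hc : ∀ m ∈ FF E n (e+1+j), lead E n (e + (j+1)) (T m) = lead E n (e+j) m := by
      intro m hm
      exact hT.lead (i := e + j) (mem_FF.2 fun a l hl => mem_FF.1 hm a l (by omega))
    apply le_antisymm
    · rintro _ ⟨m, hm, rfl⟩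
      have hm : m ∈ W ⊓ FF E n (e+1+(j+1)) := hm
      rw [← ZZ_eq hT W hW e hcov, mem_ZZ_succ] at hm
      obtain ⟨z, hz, z', hz', rfl⟩ := hm
      rw [ZZ_eq hT W hW e hcov] at hz hz'
      refine ⟨z', hz', ?_⟩
      rw [map_add, hc _ hz'.2]
      have : lead E n (e+(j+1)) z = 0 := by
        ext a
        exact mem_FF.1 hz.2 a _ (by omega)
      rw [this, zero_add]
    · rintro _ ⟨m, hm, rfl⟩
      exact ⟨T m, ⟨hW _ hm.1, hT.mem_FF hm.2⟩, hc _ hm.2⟩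

lemma dim_step (hT : IsT n dE T) (W : Submodule E (Fin n × ℕ →₀ E)) (hW : ∀ m ∈ W, T m ∈ W) (e : ℕ)
    (hcov : ∀ m ∈ W, ∃ j, m ∈ ZZ hT (W ⊓ FF E n (e+1)) j) :
    ∃ s d : ℕ, ∀ j, Module.finrank E ((FF E n (e + j)).map W.mkQ) + (d + j * s) = n * (e + j) := by
  refine ⟨Module.finrank E ((W ⊓ FF E n (e+1)).map (lead E n e)),
    Module.finrank E (W ⊓ FF E n e : Submodule E (Fin n × ℕ →₀ E)), fun j => ?_⟩
  have h1 : ∀ j, Module.finrank E (W ⊓ FF E n (e+j) : Submodule E (Fin n × ℕ →₀ E)) =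
    Module.finrank E (W ⊓ FF E n e : Submodule E (Fin n × ℕ →₀ E)) +
      j * Module.finrank E ((W ⊓ FF E n (e+1)).map (lead E n e)) := by
    intro j
    induction j with
    | zero => simp
    | succ j ih =>
      have := finrank_map_inf (W ⊓ FF E n (e+1+j)) (lead E n (e+j)) (W ⊓ FF E n (e + j))
        (by
          rintro m ⟨h, h'⟩
          exact ⟨h, mem_FF.2 fun a l hl => mem_FF.1 h' a l (by omega)⟩)
        (by
          rintro m ⟨h, h'⟩
          rw [← mem_FF_of_lead (by rwa [show e + j + 1 = e + 1 + j by ring])]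
          exact ⟨fun h => h.2, fun h2 => ⟨h, h2⟩⟩)
      rw [map_lead hT W hW e hcov] at this
      rw [show e + (j + 1) = e + 1 + j by ring, ← this, ih]
      ring
  rw [← h1, ← finrank_FF (E := E)]
  apply finrank_map_inf _ _ _ inf_le_right
  intro m hm
  simp only [Submodule.mem_inf, hm, and_true, Submodule.mkQ_apply, Submodule.Quotient.mk_eq_zero]

end lin
end DAE

namespace DAE
open MvPolynomial

section fin
variable {K : Type} [Field K] {n : ℕ} {δ : K → K} {D : DP K n → DP K n}

lemma IsTotalDeriv.zero (hD : IsTotalDeriv K n δ D) : D 0 = 0 := by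
  have := hD.map_add 0 0
  simpa using this

lemma IsTotalDeriv.one (hD : IsTotalDeriv K n δ D) : D 1 = 0 := by
  have := hD.leibniz 1 1
  simpa using this

lemma IsTotalDeriv.iter_zero (hD : IsTotalDeriv K n δ D) (p : ℕ) : D^[p] 0 = 0 := by
  induction p with
  | zero => rfl
  | succ p ih => rw [Function.iterate_succ_apply', ih, hD.zero]

lemma IsTotalDeriv.iter_add (hD : IsTotalDeriv K n δ D) (p : ℕ) (a b : DP K n) :
    D^[p] (a + b) = D^[p] a + D^[p] b := by
  induction p with
  | zero => rfl
  | succ p ih => simp only [Function.iterate_succ_apply', ih, hD.map_add]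

/-- `D` as an additive hom -/
def Dadd (hD : IsTotalDeriv K n δ D) : DP K n →+ DP K n where
  toFun := D
  map_zero' := hD.zero
  map_add' := hD.map_add

lemma iter_mul (hD : IsTotalDeriv K n δ D) (m : ℕ) (a b : DP K n) :
    D^[m] (a * b) = ∑ ij ∈ Finset.HasAntidiagonal.antidiagonal m, m.choose ij.1 • (D^[ij.1] a * D^[ij.2] b) := by
  induction m with
  | zero => simp
  | succ m ih =>
    rw [Finset.sum_antidiagonal_choose_succ_nsmul (M := DP K n) (fun i j => D^[i] a * D^[j] b) m,
      Function.iterate_succ_apply', ih]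
    change Dadd hD _ = _
    rw [map_sum, ← Finset.sum_add_distrib]
    refine Finset.sum_congr rfl fun ij hij => ?_
    rw [map_nsmul]
    change _ • D (_ * _) = _
    rw [hD.leibniz, Function.iterate_succ_apply', Function.iterate_succ_apply', smul_add,
      mul_comm (D^[ij.2] b)]
    congr 2
    have := Finset.HasAntidiagonal.mem_antidiagonal.1 hij
    have h2 := Nat.choose_symm_add (a := ij.1) (b := ij.2)
    rw [this] at h2
    exact h2

/-- largest differential ideal inside `q` -/
def sharp (hD : IsTotalDeriv K n δ D) (q : Ideal (DP K n)) : Ideal (DP K n) where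
  carrier := {g | ∀ p, D^[p] g ∈ q}
  add_mem' := fun {a b} ha hb p => by rw [hD.iter_add]; exact add_mem (ha p) (hb p)
  zero_mem' := fun p => by rw [hD.iter_zero]; exact zero_mem _
  smul_mem' := fun c x hx p => by
    rw [smul_eq_mul, iter_mul hD]
    exact sum_mem fun ij _ => nsmul_mem (q.mul_mem_left _ (hx _)) _

lemma mem_sharp (hD : IsTotalDeriv K n δ D) (q : Ideal (DP K n)) (g : DP K n) :
    g ∈ sharp hD q ↔ ∀ p, D^[p] g ∈ q := Iff.rfl

lemma sharp_le (hD : IsTotalDeriv K n δ D) (q : Ideal (DP K n)) : sharp hD q ≤ q := fun g hg => hg 0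

lemma sharp_prime [CharZero K] (hD : IsTotalDeriv K n δ D) (q : Ideal (DP K n)) [hq : q.IsPrime] :
    (sharp hD q).IsPrime := by
  classical
  refine ⟨fun h => hq.ne_top (top_le_iff.1 (h ▸ sharp_le hD q)), ?_⟩
  intro a b hab
  by_contra hcon
  push Not at hcon
  obtain ⟨ha, hb⟩ := hcon
  rw [mem_sharp] at ha hb
  push Not at ha hb
  let i := Nat.find ha
  let j := Nat.find hb
  have hi : D^[i] a ∉ q := Nat.find_spec ha
  have hj : D^[j] b ∉ q := Nat.find_spec hb
  have hi' : ∀ k < i, D^[k] a ∈ q := fun k hk => by simpa using Nat.find_min ha hk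
  have hj' : ∀ k < j, D^[k] b ∈ q := fun k hk => by simpa using Nat.find_min hb hk
  have h := hab (i + j)
  rw [iter_mul hD, ← Finset.add_sum_erase _ _ (show (i, j) ∈ Finset.HasAntidiagonal.antidiagonal (i + j) from
    Finset.HasAntidiagonal.mem_antidiagonal.2 rfl)] at h
  have h2 : ∑ ij ∈ (Finset.HasAntidiagonal.antidiagonal (i+j)).erase (i, j),
      (i+j).choose ij.1 • (D^[ij.1] a * D^[ij.2] b) ∈ q := by
    refine sum_mem fun ij hij => nsmul_mem ?_ _
    obtain ⟨h1, h2⟩ := Finset.mem_erase.1 hij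
    have h3 := Finset.HasAntidiagonal.mem_antidiagonal.1 h2
    rcases lt_trichotomy ij.1 i with h4 | h4 | h4
    · exact q.mul_mem_right _ (hi' _ h4)
    · exact absurd (Prod.ext h4 (by simp; omega)) h1
    · exact q.mul_mem_left _ (hj' _ (by omega))
  have h3 := (Ideal.add_mem_iff_left _ h2).1 h
  simp only at h3
  rw [nsmul_eq_mul] at h3
  rcases hq.mem_or_mem h3 with h4 | h4
  · have h5 : ((i+j).choose i : K) ≠ 0 := by
      exact_mod_cast (Nat.choose_pos (by omega)).ne'
    apply hq.ne_top
    apply Ideal.eq_top_of_isUnit_mem _ h4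
    have : (((i+j).choose i : ℕ) : DP K n) = C ((i+j).choose i : K) := by simp
    rw [this]
    exact (IsUnit.mk0 _ h5).map C
  · exact (hq.mem_or_mem h4).elim hi hj

/-- the differential ideal as an ordinary span -/
def II (D : DP K n → DP K n) {r : ℕ} (f : Fin r → DP K n) : Ideal (DP K n) :=
  Ideal.span (Set.range fun p : Fin r × ℕ => D^[p.2] (f p.1))

lemma iter_mem {P : Ideal (DP K n)} (hP : IsDiffIdeal D P) {g : DP K n} (hg : g ∈ P) (p : ℕ) :
    D^[p] g ∈ P := by
  induction p with
  | zero => exact hg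
  | succ p ih => rw [Function.iterate_succ_apply']; exact hP _ ih

lemma exists_mem_II [CharZero K] (hD : IsTotalDeriv K n δ D) {r : ℕ} (f : Fin r → DP K n)
    (P : Ideal (DP K n)) (hP : IsMinimalPrimeDiff D f P) (g : DP K n) (hg : g ∈ P) :
    ∃ s, s ∉ P ∧ ∃ k : ℕ, s * g ^ k ∈ II D f := by
  by_contra hcon
  push Not at hcon
  obtain ⟨hPp, hPd, hPf, hPm⟩ := hP
  let S : Submonoid (DP K n) := P.primeCompl ⊔ Submonoid.powers g
  have hS : Disjoint (II D f : Set (DP K n)) S := by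
    rw [Set.disjoint_left]
    intro x hx hxS
    obtain ⟨s, hs, y, ⟨k, rfl⟩, rfl⟩ := Submonoid.mem_sup.1 hxS
    exact hcon s hs k hx
  obtain ⟨q, hq, hIq, hqS⟩ := Ideal.exists_le_prime_disjoint (II D f) S hS
  rw [Set.disjoint_left] at hqS
  have hqP : q ≤ P := by
    intro x hx
    by_contra hxP
    exact hqS hx (Submonoid.mem_sup_left hxP)
  have hgq : g ∉ q := fun h => hqS h (Submonoid.mem_sup_right ⟨1, pow_one g⟩)
  have := hPm (sharp hD q) (sharp_prime hD q)
    (fun a ha p => by rw [← Function.iterate_succ_apply]; exact ha (p+1))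
    (fun t p => hIq (Ideal.subset_span ⟨(t, p), rfl⟩)) ((sharp_le hD q).trans hqP)
  exact hgq (sharp_le hD q (this ▸ hg))

lemma exists_mem_fin {r : ℕ} (f : Fin r → DP K n) (x : DP K n) (hx : x ∈ II D f) :
    ∃ m : ℕ, 1 ≤ m ∧
      x ∈ Ideal.span (Set.range fun p : Fin r × Fin m => D^[(p.2 : ℕ)] (f p.1)) := by
  have hmono : ∀ m m' : ℕ, m ≤ m' →
      Ideal.span (Set.range fun p : Fin r × Fin m => D^[(p.2 : ℕ)] (f p.1)) ≤
      Ideal.span (Set.range fun p : Fin r × Fin m' => D^[(p.2 : ℕ)] (f p.1)) := by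
    intro m m' h
    apply Ideal.span_mono
    rintro _ ⟨p, rfl⟩
    exact ⟨(p.1, Fin.castLE h p.2), rfl⟩
  induction hx using Submodule.span_induction with
  | mem x hx =>
    obtain ⟨⟨t, p⟩, rfl⟩ := hx
    exact ⟨p + 1, by omega, Ideal.subset_span ⟨(t, ⟨p, by omega⟩), rfl⟩⟩
  | zero => exact ⟨1, le_rfl, zero_mem _⟩
  | add x y _ _ hx hy =>
    obtain ⟨m, hm, hx⟩ := hx
    obtain ⟨m', hm', hy⟩ := hy
    exact ⟨m + m', by omega, add_mem (hmono m _ (by omega) hx) (hmono m' _ (by omega) hy)⟩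
  | smul a x _ hx =>
    obtain ⟨m, hm, hx⟩ := hx
    exact ⟨m, hm, Ideal.mul_mem_left _ _ hx⟩

/-- `toKK` as an algebra hom -/
def piK (P : Ideal (DP K n)) [P.IsPrime] : DP K n →ₐ[K] KK K n P :=
  (IsScalarTower.toAlgHom K (DP K n ⧸ P) (KK K n P)).comp (Ideal.Quotient.mkₐ K P)

lemma piK_eq (P : Ideal (DP K n)) [P.IsPrime] (g : DP K n) : piK P g = toKK P g := rfl

lemma piK_zero (P : Ideal (DP K n)) [P.IsPrime] (g : DP K n) : piK P g = 0 ↔ g ∈ P := by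
  rw [piK_eq, toKK, RingHom.comp_apply,
    map_eq_zero_iff _ (IsFractionRing.injective (DP K n ⧸ P) (KK K n P)),
    Ideal.Quotient.eq_zero_iff_mem]

lemma qr_surj {r : ℕ} (f : Fin r → DP K n) (P : Ideal (DP K n)) [P.IsPrime] (e m : ℕ)
    (h : (qrJac D f P e m).rank = r * m) (b : Fin r × Fin m → KK K n P) :
    ∃ w : Fin n × ℕ → KK K n P, ∀ i : Fin r × Fin m,
      Finsupp.linearCombination (KK K n P) w (dd (piK P) (D^[(i.2 : ℕ)] (f i.1))) = b i := by
  classical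
  have h1 : LinearMap.range (qrJac D f P e m).mulVecLin = ⊤ := by
    apply Submodule.eq_top_of_finrank_eq
    rw [← Matrix.rank, h]
    simp
  obtain ⟨u, hu⟩ := LinearMap.range_eq_top.1 h1 b
  let w : Fin n × ℕ → KK K n P := fun v => if hv : v.2 < m + e then u (v.1, ⟨v.2, hv⟩) else 0
  refine ⟨w, fun i => ?_⟩
  rw [← hu, Matrix.mulVecLin_apply, Matrix.mulVec, dotProduct,
    Finsupp.linearCombination_apply]
  let φ : Fin n × Fin (m + e) ↪ Fin n × ℕ := ⟨fun v => (v.1, (v.2 : ℕ)), by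
      rintro ⟨a, b⟩ ⟨c, d⟩ h
      simp only [Prod.mk.injEq] at h
      ext
      · simp [h.1]
      · simp [h.2]⟩
  have h2 : ∑ q, qrJac D f P e m i q * u q =
      ∑ v ∈ Finset.univ.map φ, dd (piK P) (D^[(i.2 : ℕ)] (f i.1)) v • w v := by
    rw [Finset.sum_map]
    refine Finset.sum_congr rfl fun q _ => ?_
    rw [dd_apply, piK_eq, smul_eq_mul]
    have : w (φ q) = u q := dif_pos (show (q.2 : ℕ) < m + e from q.2.2)
    rw [this]; rfl
  rw [h2]
  refine (Finsupp.sum_of_support_subset _ (Finset.subset_union_left (s₂ := Finset.univ.map φ))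
    _ (by simp)).trans ?_
  symm
  apply Finset.sum_subset Finset.subset_union_right
  rintro v - hv
  have : w v = 0 := by
    simp only [w]
    rw [dif_neg]
    intro h
    exact hv (Finset.mem_map.2 ⟨(v.1, ⟨v.2, h⟩), Finset.mem_univ _, rfl⟩)
  rw [this, smul_zero]

lemma WW_eq [CharZero K] (hD : IsTotalDeriv K n δ D) {r : ℕ} (f : Fin r → DP K n)
    (P : Ideal (DP K n)) [P.IsPrime] (hP : IsMinimalPrimeDiff D f P) (e : ℕ)
    (hqr : IsQuasiRegularAt D f P e) :
    WW (piK P) = Submodule.span (KK K n P)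
      (Set.range fun p : Fin r × ℕ => dd (piK P) (D^[p.2] (f p.1))) := by
  have hin : ∀ t p, D^[p] (f t) ∈ P := fun t p => iter_mem hP.2.1 (hP.2.2.1 t) p
  apply le_antisymm
  · refine Submodule.span_le.2 ?_
    rintro _ ⟨g, hg, rfl⟩
    have hg : piK P g = 0 := hg
    obtain ⟨s, hs, k, hk⟩ := exists_mem_II hD f P hP g ((piK_zero P g).1 hg)
    obtain ⟨m, hm, hx⟩ := exists_mem_fin f _ hk
    have := jacobian (piK P) (fun p : Fin r × Fin m => D^[(p.2 : ℕ)] (f p.1))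
      (fun i => (piK_zero P _).2 (hin _ _)) (qr_surj f P e m (hqr m hm)) s g k
      (fun h => hs ((piK_zero P _).1 h)) hg hx
    refine Submodule.span_mono ?_ this
    rintro _ ⟨p, rfl⟩
    exact ⟨(p.1, p.2), rfl⟩
  · refine Submodule.span_le.2 ?_
    rintro _ ⟨p, rfl⟩
    exact Submodule.subset_span ⟨_, (piK_zero P _).2 (hin _ _), rfl⟩

/-- `g ↦ π g + ε π (D g)` -/
def psi0 (hD : IsTotalDeriv K n δ D) (P : Ideal (DP K n)) [P.IsPrime] :
    DP K n →+* TrivSqZeroExt (KK K n P) (KK K n P) where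
  toFun g := (TrivSqZeroExt.inl (piK P g) + TrivSqZeroExt.inr (piK P (D g)))
  map_one' := by rw [hD.one, map_one, map_zero]; simp
  map_zero' := by rw [hD.zero, map_zero]; simp
  map_add' a b := by
    rw [hD.map_add]
    ext <;> simp
  map_mul' a b := by
    rw [hD.leibniz]
    ext
    · simp
    · simp [mul_comm]

lemma exists_dE (hD : IsTotalDeriv K n δ D) (P : Ideal (DP K n)) [P.IsPrime]
    (hP : IsDiffIdeal D P) :
    ∃ dE : KK K n P → KK K n P, (∀ a b, dE (a + b) = dE a + dE b) ∧
      (∀ a b, dE (a * b) = a * dE b + b * dE a) ∧ ∀ g, dE (piK P g) = piK P (D g) := by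
  let ψ1 : DP K n ⧸ P →+* TrivSqZeroExt (KK K n P) (KK K n P) :=
    Ideal.Quotient.lift P (psi0 hD P) (by
      intro a ha
      have h1 := (piK_zero P a).2 ha
      have h2 := (piK_zero P _).2 (hP a ha)
      simp [psi0, h1, h2])
  have hfst : ∀ x, (ψ1 x).fst = algebraMap _ (KK K n P) x := by
    intro x
    obtain ⟨g, rfl⟩ := Ideal.Quotient.mk_surjective x
    simp [ψ1, psi0]
    rfl
  have hu : ∀ y : nonZeroDivisors (DP K n ⧸ P), IsUnit (ψ1 y) := by
    intro y
    rw [TrivSqZeroExt.isUnit_iff_isUnit_fst, hfst]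
    exact IsLocalization.map_units _ y
  let Φ : KK K n P →+* TrivSqZeroExt (KK K n P) (KK K n P) := IsLocalization.lift hu
  have hΦ : ∀ x, Φ (algebraMap _ _ x) = ψ1 x := fun x => IsLocalization.lift_eq hu x
  have hid : (TrivSqZeroExt.fstHom (KK K n P) (KK K n P) (KK K n P) : _ →+* KK K n P).comp Φ = RingHom.id _ := by
    apply IsLocalization.ringHom_ext (nonZeroDivisors (DP K n ⧸ P))
    refine RingHom.ext fun x => ?_
    simp [hΦ, hfst]
  have hid' : ∀ x, (Φ x).fst = x := fun x => congrArg (fun h => h x) hid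
  refine ⟨fun x => (Φ x).snd, fun a b => by simp, fun a b => ?_, fun g => ?_⟩
  · simp [hid', mul_comm]
  · have : piK P g = algebraMap _ _ (Ideal.Quotient.mk P g) := rfl
    rw [this]
    change (Φ _).snd = _
    rw [hΦ]
    simp [ψ1, psi0]

/-- shift of order -/
def shiftE (n : ℕ) : Fin n × ℕ → Fin n × ℕ := fun v => (v.1, v.2 + 1)

lemma shiftE_inj (n : ℕ) : Function.Injective (shiftE n) := by
  rintro ⟨a, b⟩ ⟨c, d⟩ h
  simpa [shiftE] using h

lemma exists_T {E : Type} [Field E] (dE : E → E) (hadd : ∀ a b, dE (a + b) = dE a + dE b)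
    (hmul : ∀ a b, dE (a * b) = a * dE b + b * dE a) :
    ∃ T : (Fin n × ℕ →₀ E) → (Fin n × ℕ →₀ E), IsT n dE T := by
  have h0 : dE 0 = 0 := by simpa using hadd 0 0
  let T : (Fin n × ℕ →₀ E) → (Fin n × ℕ →₀ E) := fun m =>
    Finsupp.mapRange dE h0 m + Finsupp.mapDomain (shiftE n) m
  have hc0 : ∀ m j, T m (j, 0) = dE (m (j, 0)) := by
    intro m j
    simp only [T, Finsupp.add_apply, Finsupp.mapRange_apply]
    rw [Finsupp.mapDomain_of_notMem_range, add_zero]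
    rintro ⟨⟨a, b⟩, h⟩
    simp [shiftE] at h
  have hc1 : ∀ m j l, T m (j, l+1) = dE (m (j, l+1)) + m (j, l) := by
    intro m j l
    simp only [T, Finsupp.add_apply, Finsupp.mapRange_apply]
    rw [show (j, l+1) = shiftE n (j, l) from rfl, Finsupp.mapDomain_apply (shiftE_inj n)]
  refine ⟨T, h0, ?_, ?_, hc0, hc1⟩
  · intro m m'
    ext ⟨j, l⟩
    cases l <;> simp [hc0, hc1, hadd]
    ring
  · intro a m
    ext ⟨j, l⟩
    cases l <;> simp [hc0, hc1, hmul] <;> ring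

lemma pderiv_D0 (hD : IsTotalDeriv K n δ D) (j : Fin n) (g : DP K n) :
    pderiv (j, 0) (D g) = D (pderiv (j, 0) g) := by
  classical
  induction g using MvPolynomial.induction_on with
  | C a => simp [hD.map_C, hD.zero]
  | add p q hp hq => simp [hD.map_add, hp, hq]
  | mul_X p v hp =>
    obtain ⟨a, b⟩ := v
    simp only [hD.leibniz, hD.map_X, map_add, Derivation.leibniz, hp, hD.map_add, smul_eq_mul]
    have h1 : pderiv (j, 0) (X (a, b + 1) : DP K n) = 0 := by
      rw [pderiv_X_of_ne]; simp
    have h2 : D (pderiv (j, 0) (X (a, b) : DP K n)) = 0 := by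
      rw [pderiv_X, Pi.single_apply]
      split_ifs
      · exact hD.one
      · exact hD.zero
    rw [h1, h2]; ring

lemma pderiv_D1 (hD : IsTotalDeriv K n δ D) (j : Fin n) (l : ℕ) (g : DP K n) :
    pderiv (j, l + 1) (D g) = D (pderiv (j, l + 1) g) + pderiv (j, l) g := by
  classical
  induction g using MvPolynomial.induction_on with
  | C a => simp [hD.map_C, hD.zero]
  | add p q hp hq => simp [hD.map_add, hp, hq]; ring
  | mul_X p v hp =>
    obtain ⟨a, b⟩ := v
    simp only [hD.leibniz, hD.map_X, map_add, Derivation.leibniz, hp, hD.map_add, smul_eq_mul]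
    have h1 : pderiv (j, l + 1) (X (a, b + 1) : DP K n) = pderiv (j, l) (X (a, b)) := by
      simp only [pderiv_X, Pi.single_apply]; simp
    have h2 : D (pderiv (j, l + 1) (X (a, b) : DP K n)) = 0 := by
      rw [pderiv_X, Pi.single_apply]
      split_ifs
      · exact hD.one
      · exact hD.zero
    rw [h1, h2]; ring

lemma T_dd (hD : IsTotalDeriv K n δ D) (P : Ideal (DP K n)) [P.IsPrime]
    {dE : KK K n P → KK K n P} (hdE : ∀ g, dE (piK P g) = piK P (D g))
    {T : (Fin n × ℕ →₀ KK K n P) → (Fin n × ℕ →₀ KK K n P)} (hT : IsT n dE T) (g : DP K n) :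
    T (dd (piK P) g) = dd (piK P) (D g) := by
  ext ⟨j, l⟩
  cases l with
  | zero => rw [hT.coeff0, dd_apply, dd_apply, hdE, pderiv_D0 hD]
  | succ l => rw [hT.coeff1, dd_apply, dd_apply, dd_apply, hdE, pderiv_D1 hD, map_add]

lemma dd_mem_FF (P : Ideal (DP K n)) [P.IsPrime] {r : ℕ} (f : Fin r → DP K n) (e : ℕ)
    (he : e = Finset.univ.sup fun p : Fin r × Fin n => ordIn (f p.1) p.2) (t : Fin r) :
    dd (piK P) (f t) ∈ FF (KK K n P) n (e + 1) := by
  rw [mem_FF]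
  intro j l hl
  rw [dd_apply, pderiv_eq_zero_of_notMem_vars, map_zero]
  intro hv
  have h1 : l ≤ ordIn (f t) j :=
    Finset.le_sup (f := fun v : Fin n × ℕ => v.2)
      (show (j, l) ∈ (f t).vars.filter (fun v => v.1 = j) from Finset.mem_filter.2 ⟨hv, rfl⟩)
  have h2 : ordIn (f t) j ≤ e := by
    rw [he]
    exact Finset.le_sup (f := fun p : Fin r × Fin n => ordIn (f p.1) p.2) (Finset.mem_univ (t, j))
  omega

lemma main_dim [CharZero K] (hD : IsTotalDeriv K n δ D) {r : ℕ} (f : Fin r → DP K n)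
    (P : Ideal (DP K n)) [P.IsPrime] (hP : IsMinimalPrimeDiff D f P) (e : ℕ)
    (he : e = Finset.univ.sup fun p : Fin r × Fin n => ordIn (f p.1) p.2)
    (hqr : IsQuasiRegularAt D f P e) :
    ∃ s d : ℕ, ∀ j, Module.finrank (KK K n P) ((FF (KK K n P) n (e + j)).map (WW (piK P)).mkQ) +
      (d + j * s) = n * (e + j) := by
  obtain ⟨dE, ha, hm, hdE⟩ := exists_dE hD P hP.2.1
  obtain ⟨T, hT⟩ := exists_T (n := n) dE ha hm
  have hTd := T_dd hD P hdE hT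
  have hin : ∀ t p, D^[p] (f t) ∈ P := fun t p => iter_mem hP.2.1 (hP.2.2.1 t) p
  have hWd : ∀ g ∈ P, dd (piK P) g ∈ WW (piK P) := fun g hg =>
    Submodule.subset_span ⟨g, (piK_zero P g).2 hg, rfl⟩
  have hW : ∀ m ∈ WW (piK P), T m ∈ WW (piK P) := by
    intro m hm
    induction hm using Submodule.span_induction with
    | mem x hx =>
      obtain ⟨g, hg, rfl⟩ := hx
      rw [hTd]
      exact hWd _ (hP.2.1 _ ((piK_zero P g).1 hg))
    | zero => rw [hT.zero]; exact zero_mem _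
    | add x y _ _ hx hy => rw [hT.add]; exact add_mem hx hy
    | smul a x hx' hx =>
      rw [hT.smul]
      exact add_mem (Submodule.smul_mem _ _ hx') (Submodule.smul_mem _ _ hx)
  refine dim_step hT (WW (piK P)) hW e ?_
  intro m hm
  rw [WW_eq hD f P hP e hqr] at hm
  induction hm using Submodule.span_induction with
  | mem x hx =>
    obtain ⟨⟨t, p⟩, rfl⟩ := hx
    refine ⟨p, ?_⟩
    simp only
    induction p with
    | zero => exact ⟨hWd _ (hin t 0), dd_mem_FF P f e he t⟩
    | succ p ih =>
      rw [Function.iterate_succ_apply', ← hTd]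
      exact T_mem_ZZ hT _ _ ih
  | zero => exact ⟨0, zero_mem _⟩
  | add x y _ _ hx hy =>
    obtain ⟨a, hx⟩ := hx
    obtain ⟨b, hy⟩ := hy
    exact ⟨a + b, add_mem (ZZ_mono hT _ (by omega) hx) (ZZ_mono hT _ (by omega) hy)⟩
  | smul c x _ hx =>
    obtain ⟨a, hx⟩ := hx
    exact ⟨a, Submodule.smul_mem _ _ hx⟩

lemma hasTrdeg_FF [CharZero K] (P : Ideal (DP K n)) [P.IsPrime] (i : ℕ) :
    HasTrdeg K (FractionRing (AP K n i ⧸ Pc i P)) (Module.finrank (KK K n P)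
      ((FF (KK K n P) n (i + 1)).map (WW (piK P)).mkQ)) := by
  rw [FF_eq_span, Submodule.map_span, ← Set.range_comp]
  let τ : Fin n × Fin (i + 1) → Fin n × ℕ := fun v => (v.1, (v.2 : ℕ))
  let A := AP K n i ⧸ Pc i P
  let F := FractionRing A
  let j0 : A →ₐ[K] KK K n P := Ideal.Quotient.liftₐ (Pc i P) ((piK P).comp (rename τ)) (by
    intro a ha
    exact (piK_zero P _).2 ha)
  have hj0 : Function.Injective j0 := by
    rw [injective_iff_map_eq_zero]
    intro a ha
    obtain ⟨g, rfl⟩ := Ideal.Quotient.mk_surjective a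
    exact Ideal.Quotient.eq_zero_iff_mem.2 ((piK_zero P _).1 ha)
  let j : F →ₐ[K] KK K n P := IsFractionRing.liftAlgHom hj0
  let y0 : Fin n × Fin (i + 1) → A := fun v => Ideal.Quotient.mk _ (X v)
  let y : Fin n × Fin (i + 1) → F := fun v => algebraMap A F (y0 v)
  have hy : ∀ v, j (y v) = piK P (X (τ v)) := by
    intro v
    have : j (y v) = j0 (y0 v) := IsFractionRing.lift_algebraMap hj0 _
    rw [this]
    change (piK P) (rename τ (X v)) = _
    rw [rename_X]
  have htop : ∀ a : A, algebraMap A F a ∈ Algebra.adjoin K (Set.range y) := by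
    intro a
    obtain ⟨g, rfl⟩ := Ideal.Quotient.mk_surjective a
    have : algebraMap A F (Ideal.Quotient.mk _ g) = aeval y g := by
      have h : ((IsScalarTower.toAlgHom K A F).comp (Ideal.Quotient.mkₐ K (Pc i P))) = aeval y := by
        ext v
        simp [y, y0]
        rfl
      exact congrArg (fun h => h g) h
    rw [this, Algebra.adjoin_range_eq_range_aeval]
    exact ⟨g, rfl⟩
  have halg : Algebra.IsAlgebraic (Algebra.adjoin K (Set.range y)) F := by
    constructor
    intro x
    obtain ⟨a, b, hb, rfl⟩ := IsFractionRing.div_surjective (A := A) x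
    have hA : ∀ a : A, IsAlgebraic (Algebra.adjoin K (Set.range y)) (algebraMap A F a) := fun a =>
      isAlgebraic_algebraMap (⟨algebraMap A F a, htop a⟩ : Algebra.adjoin K (Set.range y))
    rw [div_eq_mul_inv]
    exact (hA a).mul (hA b).inv
  exact trdeg_dim (piK P) τ j y hy

end fin

/-- The Hilbert–Kolchin regularity of `𝔓` is at most `e−1`: if `c`
satisfies `trdeg_K Frac(A_i/(A_i∩𝔓)) = (n−r)(i+1)+c` for all large `i` (so
`c = ord 𝔓`), then this equality already holds for all `i ≥ e−1`; in particular for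
first-order systems (`e = 1`) it holds for all `i ∈ ℕ₀`. -/
theorem hilbertKolchin_regularity_le
    {K : Type} [Field K] [CharZero K] {n r : ℕ} (hrn : r ≤ n)
    (δ : K → K) (hδ : IsDeriv K δ)
    (D : DP K n → DP K n) (hD : IsTotalDeriv K n δ D)
    (f : Fin r → DP K n)
    (e : ℕ) (he : e = Finset.univ.sup fun p : Fin r × Fin n => ordIn (f p.1) p.2)
    (he1 : 1 ≤ e)
    (𝔓 : Ideal (DP K n)) [𝔓.IsPrime]
    (hmin : IsMinimalPrimeDiff D f 𝔓)
    (hqr : IsQuasiRegularAt D f 𝔓 e)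
    (hsr : StandingRank D f 𝔓 e)
    (c : ℕ)
    (hord : ∃ i₀ : ℕ, ∀ i : ℕ, i₀ ≤ i →
      HasTrdeg K (FractionRing (AP K n i ⧸ Pc i 𝔓)) ((n - r) * (i + 1) + c)) :
    (∀ i : ℕ, e - 1 ≤ i →
      HasTrdeg K (FractionRing (AP K n i ⧸ Pc i 𝔓)) ((n - r) * (i + 1) + c)) ∧
    (e = 1 → ∀ i : ℕ,
      HasTrdeg K (FractionRing (AP K n i ⧸ Pc i 𝔓)) ((n - r) * (i + 1) + c)) := by
  suffices H : ∀ i : ℕ, e - 1 ≤ i →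
      HasTrdeg K (FractionRing (AP K n i ⧸ Pc i 𝔓)) ((n - r) * (i + 1) + c) from
    ⟨H, fun h1 i => H i (by omega)⟩
  obtain ⟨s, d, hsd⟩ := main_dim hD f 𝔓 hmin e he hqr
  obtain ⟨i₀, hi₀⟩ := hord
  obtain ⟨e, rfl⟩ : ∃ e', e = e' + 1 := ⟨e - 1, by omega⟩
  obtain ⟨q, rfl⟩ : ∃ q, n = r + q := ⟨n - r, by omega⟩
  rw [Nat.add_sub_cancel_left] at *
  have key : ∀ j, i₀ ≤ e + j → q * (e + j + 1) + c + (d + j * s) = (r + q) * (e + j + 1) := by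
    intro j hj
    have h1 := hasTrdeg_unique (hi₀ _ hj) (hasTrdeg_FF 𝔓 (e + j))
    rw [h1]
    have h2 := hsd j
    rw [show e + 1 + j = e + j + 1 by ring] at h2
    exact h2
  have k1 := key i₀ (by omega)
  have k2 := key (i₀ + 1) (by omega)
  have hs : s = r := by nlinarith
  subst hs
  have hcd : c + d = s * (e + 1) := by nlinarith
  intro i hi
  obtain ⟨j, rfl⟩ : ∃ j, i = e + j := ⟨i - e, by omega⟩
  have h2 := hsd j
  rw [show e + 1 + j = e + j + 1 by ring] at h2
  have h3 := hasTrdeg_FF 𝔓 (e + j)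
  convert h3 using 1
  nlinarith

end DAE
end
end

section
/- Let 𝔓 ⊂ K{X_1,…,X_n} be a minimal prime differential ideal containing polynomials f_1,…,f_r, assume the DAE system defined by f_1,…,f_r is quasi-regular at 𝔓 and satisfies the standing rank hypothesis, and let σ be the 𝔓-differentiation index. Then ord(𝔓) = er − μ_σ. -/
set_option synthInstance.maxHeartbeats 1000000
set_option maxHeartbeats 4000000

noncomputable section

section
open KaehlerDifferential

theorem aux_dspan {K E : Type} [Field K] [CharZero K] [Field E] [Algebra K E]
    (V : Submodule E (Ω[E⁄K])) (F : IntermediateField K E) (hF : ∀ x ∈ F, D K E x ∈ V)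
    (z : E) (hz : IsAlgebraic F z) : D K E z ∈ V := by
  have : CharZero E := charZero_of_injective_algebraMap (algebraMap K E).injective
  let θ : Derivation K E (Ω[E⁄K] ⧸ V) := V.mkQ.compDer (D K E)
  have hθ : ∀ x, θ x = 0 ↔ D K E x ∈ V := fun x => by
    simp [θ]
  have hθF : ∀ c : F, θ (c : E) = 0 := fun c => (hθ _).2 (hF _ c.2)
  let θ' : Derivation F E (Ω[E⁄K] ⧸ V) :=
    { toFun := θ
      map_add' := map_add θ
      map_smul' := fun c x => by
        change θ ((c : E) * x) = (c : E) • θ x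
        rw [Derivation.leibniz, hθF, smul_zero, add_zero]
      map_one_eq_zero' := by simp
      leibniz' := fun a b => Derivation.leibniz _ _ _ }
  rw [← hθ]
  change θ' z = 0
  have hi : IsIntegral F z := hz.isIntegral
  have h1 := θ'.map_aeval (minpoly F z) z
  rw [minpoly.aeval, map_zero] at h1
  have hsep : (minpoly F z).Separable := (minpoly.irreducible hi).separable
  have h2 : Polynomial.aeval z (Polynomial.derivative (minpoly F z)) ≠ 0 :=
    hsep.aeval_derivative_ne_zero (minpoly.aeval _ _)
  exact (smul_eq_zero.1 h1.symm).resolve_left h2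

open scoped IntermediateField.algebraAdjoinAdjoin in
theorem aux_dlin {K E ι : Type} [Field K] [CharZero K] [Field E] [Algebra K E]
    (y : ι → E) (hy : IsTranscendenceBasis K y) :
    LinearIndependent E (fun i => D K E (y i)) := by
  have : CharZero E := charZero_of_injective_algebraMap (algebraMap K E).injective
  let T0 := Algebra.adjoin K (Set.range y)
  let F0 := IntermediateField.adjoin K (Set.range y)
  have : IsFractionRing T0 F0 := inferInstance
  have : IsScalarTower T0 F0 E := IsScalarTower.of_algebraMap_eq (fun _ => rfl)
  have : Algebra.FormallyEtale T0 F0 :=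
    Algebra.FormallyEtale.of_isLocalization (nonZeroDivisors T0)
  have : Algebra.IsAlgebraic F0 E := hy.isAlgebraic_field
  have : CharZero F0 := inferInstance
  have : Algebra.FormallyEtale F0 E := Algebra.FormallyEtale.of_isSeparable F0 E
  have : Algebra.FormallyEtale T0 E := Algebra.FormallyEtale.comp T0 F0 E
  let eqv : MvPolynomial ι K ≃ₐ[K] T0 := hy.1.aevalEquiv
  -- linear independence via functionals
  rw [linearIndependent_iff']
  intro s g hg i hi
  classical
  -- derivation on T0 dual to y i
  let d0 : Derivation K (MvPolynomial ι K) (MvPolynomial ι K) := MvPolynomial.pderiv i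
  let d1 : Derivation K T0 T0 :=
    { toFun := fun x => eqv (d0 (eqv.symm x))
      map_add' := by intros; simp
      map_smul' := by intros; simp
      map_one_eq_zero' := by simp
      leibniz' := by intros; simp }
  have h1 : ∀ j, d1 (eqv (MvPolynomial.X j)) = if j = i then 1 else 0 := fun j => by
    change eqv (d0 (eqv.symm _)) = _
    simp only [AlgEquiv.symm_apply_apply, d0, MvPolynomial.pderiv_X]
    by_cases h : j = i
    · subst h; simp
    · simp [h]
  let l : Ω[T0⁄K] →ₗ[T0] E := (Algebra.linearMap T0 E).comp d1.liftKaehlerDifferential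
  let l' : TensorProduct T0 E (Ω[T0⁄K]) →ₗ[E] E := 
    (LinearMap.liftBaseChange E l)
  have h2 := congrArg (fun x => l' ((tensorKaehlerEquivOfFormallyEtale K T0 E).symm x)) hg
  have h3 : ∀ j, y j = algebraMap T0 E (eqv (MvPolynomial.X j)) := fun j => by
    have := hy.1.algebraMap_aevalEquiv (MvPolynomial.X j)
    rw [this]; simp
  simp only [map_sum, map_smul, map_zero] at h2
  have h4 : ∀ j, l' ((tensorKaehlerEquivOfFormallyEtale K T0 E).symm (D K E (y j))) = if j = i then 1 else 0 := fun j => by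
    rw [h3, tensorKaehlerEquivOfFormallyEtale_symm_D_algebraMap]
    simp only [l', LinearMap.liftBaseChange_tmul, l, LinearMap.comp_apply, Derivation.liftKaehlerDifferential_comp_D, h1]
    by_cases h : j = i <;> simp [h]
  simp only [h4] at h2
  simpa [hi] using h2

theorem aux_trdeg {K E L ι : Type} [Field K] [CharZero K] [Field E] [Algebra K E] [Field L]
    [Algebra K L] (j : L →ₐ[K] E) (g : ι → L) (hg : IntermediateField.adjoin K (Set.range g) = ⊤)
    (d : ℕ) (s : Finset L) (hs : IsTranscendenceBasis K (fun x : {x : L // x ∈ s} => x.1))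
    (hd : s.card = d) :
    Module.finrank E (Submodule.span E (Set.range fun i => D K E (j (g i)))) = d := by
  let y : s → E := fun x => j x.1
  have hy : AlgebraicIndependent K y := hs.1.map' j.injective
  have hlin : LinearIndependent E (fun x : s => D K E (y x)) := by
    obtain ⟨Y, hY1, hY2⟩ := exists_isTranscendenceBasis_superset (s := Set.range y) hy.to_subtype_range
    have := aux_dlin _ hY2
    have h := this.comp (fun x : s => (⟨y x, hY1 ⟨x, rfl⟩⟩ : Y)) (fun a b hab => 
      hy.injective (by simpa using hab))
    exact h
  have hcard := finrank_span_eq_card hlin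
  have hd' : Fintype.card s = d := by simp [hd]
  rw [hd'] at hcard
  rw [← hcard]
  -- span equality
  have key : ∀ (V : Submodule E (Ω[E⁄K])) (G : Set L), (∀ x ∈ G, D K E (j x) ∈ V) →
      (∀ z : L, IsAlgebraic (IntermediateField.adjoin K G) z) → ∀ z : L, D K E (j z) ∈ V := by
    intro V G hG halg z
    have hF : ∀ x ∈ IntermediateField.adjoin K (j '' G), D K E x ∈ V := by
      intro x hx
      induction hx using IntermediateField.adjoin_induction with
      | mem x hx => obtain ⟨w, hw, rfl⟩ := hx; exact hG w hw
      | algebraMap x => simp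
      | add x y _ _ h1 h2 => rw [map_add]; exact V.add_mem h1 h2
      | inv x _ h => 
        rw [Derivation.leibniz_inv]; exact V.smul_mem _ h
      | mul x y _ _ h1 h2 => rw [Derivation.leibniz]; exact V.add_mem (V.smul_mem _ h2) (V.smul_mem _ h1)
    refine aux_dspan V _ hF _ ?_
    have hz := halg z
    obtain ⟨p, hp0, hp⟩ := hz
    let F1 := IntermediateField.adjoin K G
    let F2 := IntermediateField.adjoin K (j '' G)
    have hmap : F1.map j = F2 := IntermediateField.adjoin_map K G j
    let ρ : F1 →+* F2 := 
      { toFun := fun x => ⟨j x, by rw [← hmap]; exact ⟨x, x.2, rfl⟩⟩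
        map_one' := by ext; simp
        map_mul' := by intros; ext; simp
        map_zero' := by ext; simp
        map_add' := by intros; ext; simp }
    refine ⟨p.map ρ, (Polynomial.map_ne_zero_iff ρ.injective).2 hp0, ?_⟩
    rw [Polynomial.aeval_def, Polynomial.eval₂_map]
    have : (algebraMap F2 E).comp ρ = (j : L →+* E).comp (algebraMap F1 L) := by
      ext x; rfl
    rw [this]
    have h5 := congrArg j hp
    rw [Polynomial.aeval_def, map_zero] at h5
    rw [← h5]
    exact (Polynomial.hom_eval₂ p (algebraMap F1 L) (j : L →+* E) z).symm
  have hEq : Submodule.span E (Set.range fun i => D K E (j (g i))) =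
      Submodule.span E (Set.range fun x : s => D K E (y x)) := by
   apply le_antisymm
   · rw [Submodule.span_le]
     rintro _ ⟨i, rfl⟩
     refine key _ (Set.range (fun x : s => x.1)) ?_ ?_ (g i)
     · rintro _ ⟨x, rfl⟩; exact Submodule.subset_span ⟨x, rfl⟩
     · intro z
       have := hs.isAlgebraic_field
       exact Algebra.IsAlgebraic.isAlgebraic z
   · rw [Submodule.span_le]
     rintro _ ⟨i, rfl⟩
     refine key _ (Set.range g) ?_ ?_ i.1
     · rintro _ ⟨x, rfl⟩; exact Submodule.subset_span ⟨x, rfl⟩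
     · intro z
       rw [hg]
       exact isAlgebraic_algebraMap (⟨z, trivial⟩ : (⊤ : IntermediateField K L))
  rw [hEq]

end


theorem aux_abs_rn {F V W : Type} [Field F] [AddCommGroup V] [Module F V] [AddCommGroup W]
    [Module F W] (S : Submodule F V) (f : V →ₗ[F] W) (hS : FiniteDimensional F S) :
    Module.finrank F S = Module.finrank F (S ⊓ LinearMap.ker f : Submodule F V) +
      Module.finrank F (S.map f) := by
  have h := LinearMap.finrank_range_add_finrank_ker (f.domRestrict S)
  rw [LinearMap.range_domRestrict] at h
  have hk : Module.finrank F (LinearMap.ker (f.domRestrict S)) =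
      Module.finrank F (S ⊓ LinearMap.ker f : Submodule F V) := by
    rw [LinearMap.ker_domRestrict, ← Submodule.map_comap_subtype]
    exact (Submodule.equivMapOfInjective _ (Submodule.injective_subtype _) _).finrank_eq
  omega

theorem aux_abs_fd {F V W : Type} [Field F] [AddCommGroup V] [Module F V] [AddCommGroup W]
    [Module F W] (f : V →ₗ[F] W) (hf : Function.Injective f) (S : Submodule F W)
    (hS : FiniteDimensional F S) : FiniteDimensional F (S.comap f) := by
  let g : S.comap f →ₗ[F] S := f.restrict (fun x hx => hx)
  refine Module.Finite.of_injective g ?_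
  intro a b hab
  exact Subtype.ext (hf (congrArg Subtype.val hab))

theorem aux_abs_le {F V : Type} [Field F] [AddCommGroup V] [Module F V]
    (S T : Submodule F V) (h : S ≤ T) (hT : FiniteDimensional F T) : FiniteDimensional F S :=
  Submodule.finiteDimensional_of_le h

theorem aux_abs_fg {F V : Type} [Field F] [AddCommGroup V] [Module F V]
    (S : Submodule F V) (hT : FiniteDimensional F S) : S.FG :=
  (Submodule.fg_iff_finiteDimensional _).2 hT

section lin
variable {F : Type} [Field F]

/-- coefficient vectors of order `< i` -/
def auxDeg (F : Type) [Field F] (n i : ℕ) : Submodule F (Fin n × ℕ →₀ F) :=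
  Finsupp.supported F F {v | v.2 < i}

theorem aux_mem_deg {n i : ℕ} {v : Fin n × ℕ →₀ F} :
    v ∈ auxDeg F n i ↔ ∀ j l, i ≤ l → v (j, l) = 0 := by
  unfold auxDeg
  rw [Finsupp.mem_supported']
  constructor
  · intro h j l hl; exact h _ (by simpa using hl)
  · rintro h ⟨j, l⟩ hl; exact h j l (by simpa using hl)

theorem aux_deg_mono {n i j : ℕ} (h : i ≤ j) : auxDeg F n i ≤ auxDeg F n j := by
  intro v hv
  rw [aux_mem_deg] at *
  intro a l hl
  exact hv a l (h.trans hl)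

/-- the index equivalence -/
def auxDegIdx (n i : ℕ) : {v : Fin n × ℕ // v ∈ {v : Fin n × ℕ | v.2 < i}} ≃ Fin n × Fin i where
  toFun v := (v.1.1, ⟨v.1.2, v.2⟩)
  invFun w := ⟨(w.1, w.2.1), w.2.2⟩
  left_inv _ := rfl
  right_inv _ := rfl

noncomputable def auxDegEquiv (F : Type) [Field F] (n i : ℕ) :
    auxDeg F n i ≃ₗ[F] (Fin n × Fin i →₀ F) :=
  (Finsupp.supportedEquivFinsupp {v : Fin n × ℕ | v.2 < i}).trans
    (Finsupp.domLCongr (auxDegIdx n i))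

instance {n i : ℕ} : FiniteDimensional F (auxDeg F n i) :=
  Module.Finite.equiv (auxDegEquiv F n i).symm

theorem aux_deg_finrank (n i : ℕ) : Module.finrank F (auxDeg F n i) = n * i := by
  rw [(auxDegEquiv F n i).finrank_eq]
  simp

theorem aux_deg_exists {n : ℕ} (v : Fin n × ℕ →₀ F) : ∃ d, v ∈ auxDeg F n d := by
  refine ⟨v.support.sup (fun x => x.2) + 1, ?_⟩
  rw [aux_mem_deg]
  intro j l hl
  by_contra h
  have : l ≤ v.support.sup (fun x => x.2) :=
    Finset.le_sup (f := fun x : Fin n × ℕ => x.2) (Finsupp.mem_support_iff.2 h)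
  omega

/-- coefficient of order `d` -/
noncomputable def auxCoef (F : Type) [Field F] (n d : ℕ) : (Fin n × ℕ →₀ F) →ₗ[F] (Fin n → F) :=
  LinearMap.pi fun j => Finsupp.lapply (j, d)

/-- `∂` is compatible with the derivation `δ` -/
structure AuxDer (δ : F → F) (n : ℕ) (der : (Fin n × ℕ →₀ F) → (Fin n × ℕ →₀ F)) : Prop where
  zero : ∀ v j, der v (j, 0) = δ (v (j, 0))
  succ : ∀ v j l, der v (j, l + 1) = δ (v (j, l + 1)) + v (j, l)

theorem aux_der_mem {δ : F → F} (hδ0 : δ 0 = 0) {n i : ℕ} {der : (Fin n × ℕ →₀ F) → (Fin n × ℕ →₀ F)} (hder : AuxDer δ n der)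
    (v : Fin n × ℕ →₀ F) : der v ∈ auxDeg F n (i + 1) ↔ v ∈ auxDeg F n i := by
  constructor
  · intro h
    rw [aux_mem_deg] at *
    obtain ⟨d, hd⟩ := aux_deg_exists v
    rw [aux_mem_deg] at hd
    have key : ∀ m l j, d ≤ l + m → i ≤ l → v (j, l) = 0 := by
      intro m
      induction m with
      | zero => intro l j h1 h2; exact hd j l h1
      | succ m ih =>
        intro l j h1 h2
        have h3 := h j (l + 1) (by omega)
        rw [hder.succ, ih (l + 1) j (by omega) (by omega), hδ0, zero_add] at h3
        exact h3
    intro j l hl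
    exact key d l j (by omega) hl
  · intro h
    rw [aux_mem_deg] at *
    intro j l hl
    obtain ⟨l, rfl⟩ : ∃ m, l = m + 1 := ⟨l - 1, by omega⟩
    rw [hder.succ, h j (l + 1) (by omega), h j l (by omega), hδ0, add_zero]

theorem aux_div {δ : F → F} (hδ0 : δ 0 = 0) {n : ℕ} {der : (Fin n × ℕ →₀ F) → (Fin n × ℕ →₀ F)} (hder : AuxDer δ n der)
    (hadd : ∀ u v, der (u + v) = der u + der v)
    (d : ℕ) : ∀ v ∈ auxDeg F n (d + 1), ∃ u ∈ auxDeg F n d, v - der u ∈ auxDeg F n 1 := by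
  have hder0 : der 0 = 0 := by simpa using hadd 0 0
  induction d with
  | zero => 
    intro v hv
    exact ⟨0, Submodule.zero_mem _, by simpa [hder0] using hv⟩
  | succ d ih =>
    intro v hv
    let T : Fin n × ℕ →₀ F := ∑ j, Finsupp.single (j, d) (v (j, d + 1))
    have hT : ∀ j l, T (j, l) = if l = d then v (j, d + 1) else 0 := by
      intro j l
      simp only [T, Finsupp.finsetSum_apply, Finsupp.single_apply, Prod.mk.injEq]
      by_cases h : l = d
      · subst h; simp
      · have : ¬ d = l := fun h' => h h'.symm
        simp [h, this]
    have hTd : T ∈ auxDeg F n (d + 1) := by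
      rw [aux_mem_deg]; intro j l hl; rw [hT, if_neg (by omega)]
    have h1 : v - der T ∈ auxDeg F n (d + 1) := by
      rw [aux_mem_deg] at hv ⊢
      intro j l hl
      obtain ⟨l, rfl⟩ : ∃ m, l = m + 1 := ⟨l - 1, by omega⟩
      rw [Finsupp.sub_apply, hder.succ, hT, hT, if_neg (by omega), hδ0, zero_add]
      by_cases h : l = d
      · subst h; simp
      · rw [if_neg h, hv j (l + 1) (by omega), sub_zero]
    obtain ⟨u, hu, hu'⟩ := ih _ h1
    refine ⟨T + u, Submodule.add_mem _ hTd (aux_deg_mono (by omega) hu), ?_⟩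
    rw [hadd, ← sub_sub]; exact hu'

theorem aux_step {n d : ℕ} (S : Submodule F (Fin n × ℕ →₀ F)) :
    Module.finrank F (S ⊓ auxDeg F n (d + 1) : Submodule F _) =
      Module.finrank F (S ⊓ auxDeg F n d : Submodule F _) +
      Module.finrank F ((S ⊓ auxDeg F n (d + 1)).map (auxCoef F n d)) := by
  have hfin : FiniteDimensional F (S ⊓ auxDeg F n (d + 1) : Submodule F _) :=
    aux_abs_le _ _ inf_le_right inferInstance
  have : (S ⊓ auxDeg F n d) = (S ⊓ auxDeg F n (d + 1)) ⊓ LinearMap.ker (auxCoef F n d) := by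
      ext v
      simp only [Submodule.mem_inf, LinearMap.mem_ker, aux_mem_deg, and_assoc]
      refine and_congr_right fun _ => ?_
      constructor
      · intro h
        refine ⟨fun j l hl => h j l (by omega), ?_⟩
        ext j; exact h j d le_rfl
      · rintro ⟨h1, h2⟩ j l hl
        rcases hl.eq_or_lt with rfl | hl
        · exact congrFun h2 j
        · exact h1 j l hl
  rw [this]
  exact aux_abs_rn _ _ hfin

theorem aux_lin {δ : F → F} (hδ0 : δ 0 = 0) {n r e : ℕ} {derN : (Fin n × ℕ →₀ F) → (Fin n × ℕ →₀ F)}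
    {derR : (Fin r × ℕ →₀ F) → (Fin r × ℕ →₀ F)}
    (hN : AuxDer δ n derN) (hR : AuxDer δ r derR)
    (hadd : ∀ u v, derR (u + v) = derR u + derR v)
    (φ : (Fin r × ℕ →₀ F) →ₗ[F] (Fin n × ℕ →₀ F)) (hinj : Function.Injective φ)
    (hcomm : ∀ v, φ (derR v) = derN (φ v))
    (he : ∀ v ∈ auxDeg F r 1, φ v ∈ auxDeg F n (e + 1))
    (σ : ℕ)
    (hσ : ∀ k, σ ≤ k → Module.finrank F ((auxDeg F n e).comap φ ⊓ auxDeg F r k : Submodule F _) =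
      Module.finrank F ((auxDeg F n e).comap φ ⊓ auxDeg F r (k + 1) : Submodule F _))
    (i : ℕ) :
    Module.finrank F ((auxDeg F n (e + i)).comap φ) =
      Module.finrank F ((auxDeg F n e).comap φ ⊓ auxDeg F r σ : Submodule F _) + r * i := by
  have hfd : ∀ i, FiniteDimensional F ((auxDeg F n i).comap φ) := fun i => by
    exact aux_abs_fd φ hinj _ inferInstance
  -- large degree
  have hbig : ∀ i, ∃ d0, ∀ d, d0 ≤ d → (auxDeg F n i).comap φ ⊓ auxDeg F r d = (auxDeg F n i).comap φ := by
    intro i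
    have := hfd i
    obtain ⟨s, hs⟩ := aux_abs_fg _ this
    choose dd hdd using fun v : Fin r × ℕ →₀ F => aux_deg_exists v
    refine ⟨s.sup dd, fun d hd => inf_eq_left.2 ?_⟩
    rw [← hs, Submodule.span_le]
    intro v hv
    exact aux_deg_mono ((Finset.le_sup (f := dd) hv).trans hd) (hdd v)
  have hstep : ∀ i, e ≤ i → ∀ d,
      Module.finrank F ((auxDeg F n (i + 1)).comap φ ⊓ auxDeg F r (d + 1) : Submodule F _) =
      Module.finrank F ((auxDeg F n i).comap φ ⊓ auxDeg F r d : Submodule F _) + r := by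
    intro i hi d
    have hconst : auxDeg F r 1 ≤ (auxDeg F n (i + 1)).comap φ := fun v hv =>
      aux_deg_mono (by omega) (he v hv)
    have hS : ∀ u, derR u ∈ (auxDeg F n (i + 1)).comap φ ↔ u ∈ (auxDeg F n i).comap φ := fun u => by
      rw [Submodule.mem_comap, Submodule.mem_comap, hcomm, aux_der_mem hδ0 hN]
    induction d with
    | zero =>
      have h0 : auxDeg F r 0 = ⊥ := by
        rw [eq_bot_iff]; intro v hv
        rw [aux_mem_deg] at hv
        rw [Submodule.mem_bot]; ext ⟨j, l⟩; exact hv j l (Nat.zero_le _)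
      rw [zero_add, inf_eq_right.2 hconst, aux_deg_finrank, h0, inf_bot_eq, finrank_bot]
      simp
    | succ d ih =>
      rw [aux_step, ih, aux_step (d := d)]
      have : ((auxDeg F n (i + 1)).comap φ ⊓ auxDeg F r (d + 1 + 1)).map (auxCoef F r (d + 1)) =
        ((auxDeg F n i).comap φ ⊓ auxDeg F r (d + 1)).map (auxCoef F r d) := by
        have hco : ∀ u ∈ auxDeg F r (d + 1), auxCoef F r (d + 1) (derR u) = auxCoef F r d u := by
          intro u hu
          ext j
          change derR u (j, d + 1) = u (j, d)
          rw [hR.succ, aux_mem_deg.1 hu j (d + 1) le_rfl, hδ0, zero_add]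
        apply le_antisymm
        · rintro _ ⟨v, ⟨hv1, hv2⟩, rfl⟩
          obtain ⟨u, hu, hu'⟩ := aux_div hδ0 hR hadd (d + 1) v hv2
          refine ⟨u, ⟨?_, hu⟩, ?_⟩
          · apply (hS u).1
            have := Submodule.sub_mem _ hv1 (hconst hu')
            simpa using this
          · rw [← hco u hu]
            ext j
            change derR u (j, d + 1) = v (j, d + 1)
            have := aux_mem_deg.1 hu' j (d + 1) (by omega)
            rw [Finsupp.sub_apply, sub_eq_zero] at this
            exact this.symm
        · rintro _ ⟨u, ⟨hu1, hu2⟩, rfl⟩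
          exact ⟨derR u, ⟨(hS u).2 hu1, (aux_der_mem hδ0 hR u).2 hu2⟩, hco u hu2⟩
      rw [this]; omega
  have hfull : ∀ i, e ≤ i → Module.finrank F ((auxDeg F n (i + 1)).comap φ) =
      Module.finrank F ((auxDeg F n i).comap φ) + r := by
    intro i hi
    obtain ⟨d1, h1⟩ := hbig i
    obtain ⟨d2, h2⟩ := hbig (i + 1)
    have := hstep i hi (max d1 d2)
    rwa [h1 _ (le_max_left _ _), h2 _ ((le_max_right _ _).trans (Nat.le_succ _))] at this
  induction i with
  | zero =>
    obtain ⟨d1, h1⟩ := hbig e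
    have hst : ∀ m, Module.finrank F ((auxDeg F n e).comap φ ⊓ auxDeg F r (σ + m) : Submodule F _) =
      Module.finrank F ((auxDeg F n e).comap φ ⊓ auxDeg F r σ : Submodule F _) := by
      intro m
      induction m with
      | zero => rfl
      | succ m ih => rw [← ih]; exact (hσ (σ + m) (by omega)).symm
    have := hst d1
    rw [h1 _ (by omega)] at this
    simpa using this
  | succ i ih =>
    rw [← add_assoc, hfull (e + i) (by omega), ih]; ring
end lin


theorem aux_ext_der {A E : Type} [CommRing A] (𝔓 : Ideal A) [𝔓.IsPrime] [Field E] 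
    [Algebra (A ⧸ 𝔓) E] [IsFractionRing (A ⧸ 𝔓) E]
    (d : A → E) (hadd : ∀ a b, d (a + b) = d a + d b)
    (hmul : ∀ a b, d (a * b) = algebraMap (A ⧸ 𝔓) E (Ideal.Quotient.mk 𝔓 a) * d b
      + algebraMap (A ⧸ 𝔓) E (Ideal.Quotient.mk 𝔓 b) * d a)
    (hz : ∀ g ∈ 𝔓, d g = 0) :
    ∃ d' : E →+ E, (∀ a b, d' (a * b) = a * d' b + b * d' a) ∧
      ∀ a, d' (algebraMap (A ⧸ 𝔓) E (Ideal.Quotient.mk 𝔓 a)) = d a := by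
  let q : A →+* E := (algebraMap (A ⧸ 𝔓) E).comp (Ideal.Quotient.mk 𝔓)
  have h0 : d 0 = 0 := hz 0 (zero_mem _)
  have h1 : d 1 = 0 := by
    have := hmul 1 1
    simpa using this
  let Ψ : A →+* DualNumber E :=
    { toFun := fun a => TrivSqZeroExt.inl (q a) + TrivSqZeroExt.inr (d a)
      map_one' := by ext <;> simp [h1]
      map_zero' := by ext <;> simp [h0]
      map_add' := fun a b => by ext <;> simp [hadd]
      map_mul' := fun a b => by
        ext
        · simp
        · simp [hmul, q, mul_comm] }
  have hΨf : ∀ a, (Ψ a).fst = q a := fun a => by simp [Ψ]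
  have hΨs : ∀ a, (Ψ a).snd = d a := fun a => by simp [Ψ]
  let Ψ1 : A ⧸ 𝔓 →+* DualNumber E := Ideal.Quotient.lift 𝔓 Ψ (fun a ha => by
    ext
    · rw [hΨf]; simp [q, Ideal.Quotient.eq_zero_iff_mem.2 ha]
    · rw [hΨs]; simp [hz a ha])
  have hΨ1f : ∀ a, (Ψ1 a).fst = algebraMap (A ⧸ 𝔓) E a := fun a => by
    obtain ⟨a, rfl⟩ := Ideal.Quotient.mk_surjective a
    simp only [Ψ1, Ideal.Quotient.lift_mk, hΨf]; rfl
  let Ψ2 : E →+* DualNumber E := IsLocalization.lift (M := nonZeroDivisors (A ⧸ 𝔓)) (g := Ψ1) (fun y => by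
    rw [TrivSqZeroExt.isUnit_iff_isUnit_fst, hΨ1f]
    exact IsLocalization.map_units E y)
  have hΨ2 : ∀ a, Ψ2 (algebraMap (A ⧸ 𝔓) E a) = Ψ1 a := fun a => IsLocalization.lift_eq _ _
  have hf : (TrivSqZeroExt.fstHom E E E).toRingHom.comp Ψ2 = RingHom.id E := by
    apply IsLocalization.ringHom_ext (nonZeroDivisors (A ⧸ 𝔓))
    ext a
    simp [hΨ2, hΨ1f]
  have hf' : ∀ a, (Ψ2 a).fst = a := fun a => congrArg (fun g : E →+* E => g a) hf
  have hs2 : ∀ a, (Ψ2 (algebraMap (A ⧸ 𝔓) E (Ideal.Quotient.mk 𝔓 a))).snd = d a := fun a => by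
    rw [hΨ2]; exact hΨs a
  clear_value Ψ2
  refine ⟨⟨⟨fun a => (Ψ2 a).snd, by rw [map_zero]; rfl⟩, fun a b => by
    change (Ψ2 (a + b)).snd = _
    rw [map_add]; rfl⟩, fun a b => ?_, hs2⟩
  change (Ψ2 (a * b)).snd = a * (Ψ2 b).snd + b * (Ψ2 a).snd
  rw [map_mul, TrivSqZeroExt.snd_mul, hf', hf', smul_eq_mul, MulOpposite.smul_eq_mul_unop,
    MulOpposite.unop_op, mul_comm b]

section
open MvPolynomial

variable {K E : Type} [Field K] [Field E] {n : ℕ}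

/-- the differential of `g` -/
noncomputable def auxD (q : MvPolynomial (Fin n × ℕ) K →+* E) (g : MvPolynomial (Fin n × ℕ) K) :
    Fin n × ℕ →₀ E :=
  Finsupp.onFinset g.vars (fun v => q (pderiv v g)) (fun v h => by
    by_contra hv
    exact h (by rw [pderiv_eq_zero_of_notMem_vars hv, map_zero]))

theorem auxD_apply (q : MvPolynomial (Fin n × ℕ) K →+* E) (g : MvPolynomial (Fin n × ℕ) K) (v) :
    auxD q g v = q (pderiv v g) := rfl

theorem auxD_add (q : MvPolynomial (Fin n × ℕ) K →+* E) (a b : MvPolynomial (Fin n × ℕ) K) :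
    auxD q (a + b) = auxD q a + auxD q b := by
  ext v; simp [auxD_apply]

theorem auxD_mul (q : MvPolynomial (Fin n × ℕ) K →+* E) (a b : MvPolynomial (Fin n × ℕ) K) :
    auxD q (a * b) = q a • auxD q b + q b • auxD q a := by
  ext v; simp [auxD_apply, Derivation.leibniz]

theorem auxD_C (q : MvPolynomial (Fin n × ℕ) K →+* E) (a : K) :
    auxD q (C a) = 0 := by
  ext v; simp [auxD_apply]

theorem auxD_X (q : MvPolynomial (Fin n × ℕ) K →+* E) (v : Fin n × ℕ) :
    auxD q (X v) = Finsupp.single v 1 := by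
  ext w; rw [auxD_apply, Finsupp.single_apply]
  split_ifs with h
  · subst h; simp
  · rw [pderiv_X_of_ne h, map_zero]

/-- the derivation on differentials -/
noncomputable def auxPar (n : ℕ) (δ : E →+ E) (v : Fin n × ℕ →₀ E) : Fin n × ℕ →₀ E :=
  v.mapRange δ δ.map_zero + v.mapDomain (fun w => (w.1, w.2 + 1))

theorem auxPar_der (δ : E →+ E) : AuxDer δ n (auxPar n δ) where
  zero v j := by
    rw [auxPar, Finsupp.add_apply, Finsupp.mapRange_apply, Finsupp.mapDomain_of_notMem_range, add_zero]
    rintro ⟨w, hw⟩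
    simp at hw
  succ v j l := by
    rw [auxPar, Finsupp.add_apply, Finsupp.mapRange_apply]
    congr 1
    exact Finsupp.mapDomain_apply (f := fun w : Fin n × ℕ => (w.1, w.2 + 1))
      (by rintro ⟨a, b⟩ ⟨c, d⟩ h; simpa using h) v (j, l)

theorem auxPar_ext (u v : Fin n × ℕ →₀ E) (h0 : ∀ j, u (j, 0) = v (j, 0))
    (h1 : ∀ j l, u (j, l + 1) = v (j, l + 1)) : u = v := by
  ext ⟨j, l⟩
  cases l with
  | zero => exact h0 j
  | succ l => exact h1 j l

theorem auxPar_add (δ : E →+ E) (u v : Fin n × ℕ →₀ E) :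
    auxPar n δ (u + v) = auxPar n δ u + auxPar n δ v := by
  refine auxPar_ext _ _ (fun j => ?_) (fun j l => ?_)
  · simp [(auxPar_der δ).zero]
  · simp [(auxPar_der δ).succ]; ring

theorem auxPar_smul (δ : E →+ E) (hδ : ∀ a b, δ (a * b) = a * δ b + b * δ a)
    (c : E) (v : Fin n × ℕ →₀ E) :
    auxPar n δ (c • v) = c • auxPar n δ v + δ c • v := by
  refine auxPar_ext _ _ (fun j => ?_) (fun j l => ?_)
  · simp [(auxPar_der δ).zero, hδ, mul_comm]
  · simp [(auxPar_der δ).succ, hδ]; ring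

theorem auxPar_single (δ : E →+ E) (w : Fin n × ℕ) (c : E) :
    auxPar n δ (Finsupp.single w c) = Finsupp.single w (δ c) + Finsupp.single (w.1, w.2 + 1) c := by
  simp [auxPar, Finsupp.mapDomain_single]

theorem auxD_comm (q : MvPolynomial (Fin n × ℕ) K →+* E) (δK : K → K)
    (D : MvPolynomial (Fin n × ℕ) K → MvPolynomial (Fin n × ℕ) K)
    (hDadd : ∀ f g, D (f + g) = D f + D g)
    (hDmul : ∀ f g, D (f * g) = f * D g + g * D f)
    (hDC : ∀ a, D (C a) = C (δK a)) (hDX : ∀ j l, D (X (j, l)) = X (j, l + 1))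
    (δ : E →+ E) (hδ : ∀ a b, δ (a * b) = a * δ b + b * δ a) (hδq : ∀ a, δ (q a) = q (D a))
    (g : MvPolynomial (Fin n × ℕ) K) : auxD q (D g) = auxPar n δ (auxD q g) := by
  have hp0 : auxPar n δ 0 = 0 := by simpa using auxPar_add (n := n) δ 0 0
  have hX : ∀ w : Fin n × ℕ, auxD q (D (X w)) = auxPar n δ (auxD q (X w)) := by
    rintro ⟨j, l⟩
    have h1 : δ 1 = 0 := by simpa using hδ 1 1
    rw [hDX, auxD_X, auxD_X, auxPar_single, h1]; simp
  induction g using MvPolynomial.induction_on with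
  | C a => rw [hDC, auxD_C, auxD_C, hp0]
  | add a b ha hb => rw [hDadd, auxD_add, auxD_add, auxPar_add, ha, hb]
  | mul_X p w ih =>
    rw [hDmul, auxD_add, auxD_mul, auxD_mul, auxD_mul, auxPar_add, auxPar_smul _ hδ, auxPar_smul _ hδ,
      ih, hX, hδq, hδq]
    abel

/-- the map `e_{t,p} ↦ d f_t^{(p)}` -/
noncomputable def auxPhi (q : MvPolynomial (Fin n × ℕ) K →+* E)
    (D : MvPolynomial (Fin n × ℕ) K → MvPolynomial (Fin n × ℕ) K) {r : ℕ}
    (f : Fin r → MvPolynomial (Fin n × ℕ) K) : (Fin r × ℕ →₀ E) →ₗ[E] (Fin n × ℕ →₀ E) :=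
  Finsupp.linearCombination E (fun w : Fin r × ℕ => auxD q (D^[w.2] (f w.1)))

theorem auxPhi_single (q : MvPolynomial (Fin n × ℕ) K →+* E)
    (D : MvPolynomial (Fin n × ℕ) K → MvPolynomial (Fin n × ℕ) K) {r : ℕ}
    (f : Fin r → MvPolynomial (Fin n × ℕ) K) (w : Fin r × ℕ) (c : E) :
    auxPhi q D f (Finsupp.single w c) = c • auxD q (D^[w.2] (f w.1)) := by
  simp [auxPhi]

theorem auxPhi_comm (q : MvPolynomial (Fin n × ℕ) K →+* E) 
    (D : MvPolynomial (Fin n × ℕ) K → MvPolynomial (Fin n × ℕ) K)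
    (δ : E →+ E) (hδ : ∀ a b, δ (a * b) = a * δ b + b * δ a) 
    (hDq : ∀ g, auxD q (D g) = auxPar n δ (auxD q g)) {r : ℕ}
    (f : Fin r → MvPolynomial (Fin n × ℕ) K) (v : Fin r × ℕ →₀ E) :
    auxPhi q D f (auxPar r δ v) = auxPar n δ (auxPhi q D f v) := by
  have hp0 : auxPar n δ 0 = 0 := by simpa using auxPar_add (n := n) δ 0 0
  have hp0' : auxPar r δ 0 = 0 := by simpa using auxPar_add (n := r) δ 0 0
  induction v using Finsupp.induction_linear with
  | zero => rw [hp0', map_zero, hp0]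
  | add u v hu hv => rw [auxPar_add, map_add, map_add, auxPar_add, hu, hv]
  | single w c =>
    rw [auxPar_single, map_add, auxPhi_single, auxPhi_single, auxPhi_single, auxPar_smul _ hδ,
      ← hDq, ← Function.iterate_succ_apply' D, add_comm]
end


section
open MvPolynomial

/-- evaluation at power series -/
noncomputable def auxEv {K E : Type} [Field K] [Field E] {n : ℕ}
    (q : MvPolynomial (Fin n × ℕ) K →+* E) (x : Fin n × ℕ → PowerSeries E) :
    MvPolynomial (Fin n × ℕ) K →+* PowerSeries E :=
  eval₂Hom ((PowerSeries.C).comp (q.comp C)) x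

theorem auxEv_X {K E : Type} [Field K] [Field E] {n : ℕ}
    (q : MvPolynomial (Fin n × ℕ) K →+* E) (x : Fin n × ℕ → PowerSeries E) (v) :
    auxEv q x (X v) = x v := by simp [auxEv]

theorem auxEv_C {K E : Type} [Field K] [Field E] {n : ℕ}
    (q : MvPolynomial (Fin n × ℕ) K →+* E) (x : Fin n × ℕ → PowerSeries E) (a : K) :
    auxEv q x (C a) = PowerSeries.C (q (C a)) := by simp [auxEv]

theorem auxEv_const {K E : Type} [Field K] [Field E] {n : ℕ}
    (q : MvPolynomial (Fin n × ℕ) K →+* E) (x : Fin n × ℕ → PowerSeries E)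
    (hx : ∀ v, PowerSeries.constantCoeff (x v) = q (X v)) (g : MvPolynomial (Fin n × ℕ) K) :
    PowerSeries.constantCoeff (auxEv q x g) = q g := by
  have : (PowerSeries.constantCoeff).comp (auxEv q x) = q := by
    apply MvPolynomial.ringHom_ext
    · intro a; simp [auxEv_C]
    · intro v; simp [auxEv_X, hx]
  exact congrArg (fun h : MvPolynomial (Fin n × ℕ) K →+* E => h g) this

theorem auxEv_congr {K E : Type} [Field K] [Field E] {n : ℕ}
    (q : MvPolynomial (Fin n × ℕ) K →+* E) (x y : Fin n × ℕ → PowerSeries E) (m : ℕ)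
    (h : ∀ v, (PowerSeries.X : PowerSeries E) ^ m ∣ x v - y v) (g : MvPolynomial (Fin n × ℕ) K) :
    (PowerSeries.X : PowerSeries E) ^ m ∣ auxEv q x g - auxEv q y g := by
  have : (Ideal.Quotient.mk (Ideal.span {(PowerSeries.X : PowerSeries E) ^ m})).comp (auxEv q x) =
      (Ideal.Quotient.mk (Ideal.span {(PowerSeries.X : PowerSeries E) ^ m})).comp (auxEv q y) := by
    apply MvPolynomial.ringHom_ext
    · intro a; simp [auxEv_C]
    · intro v
      simp only [RingHom.comp_apply, auxEv_X]
      rw [Ideal.Quotient.eq, Ideal.mem_span_singleton]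
      exact h v
  have h2 := RingHom.congr_fun this g
  simp only [RingHom.comp_apply] at h2
  rwa [Ideal.Quotient.eq, Ideal.mem_span_singleton] at h2

theorem auxEv_taylor {K E : Type} [Field K] [Field E] {n : ℕ}
    (q : MvPolynomial (Fin n × ℕ) K →+* E) (x : Fin n × ℕ → PowerSeries E)
    (hx : ∀ v, PowerSeries.constantCoeff (x v) = q (X v))
    (l : (Fin n × ℕ →₀ E) →ₗ[E] E) (m : ℕ) (hm : 1 ≤ m) (g : MvPolynomial (Fin n × ℕ) K) :
    ∃ R, auxEv q (fun v => x v + PowerSeries.X ^ m * PowerSeries.C (l (Finsupp.single v 1))) g =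
      auxEv q x g + PowerSeries.X ^ m * PowerSeries.C (l (auxD q g)) + PowerSeries.X ^ (m + 1) * R := by
  have hS : ∀ g, ∃ S, auxEv q x g = PowerSeries.C (q g) + PowerSeries.X * S := fun g => by
    have : PowerSeries.X ∣ auxEv q x g - PowerSeries.C (q g) := by
      rw [PowerSeries.X_dvd_iff]; simp [auxEv_const q x hx]
    obtain ⟨S, hS⟩ := this
    exact ⟨S, by rw [← hS]; ring⟩
  induction g using MvPolynomial.induction_on with
  | C a => exact ⟨0, by rw [auxEv_C, auxEv_C, auxD_C]; simp⟩
  | add a b ha hb =>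
    obtain ⟨R, hR⟩ := ha
    obtain ⟨R', hR'⟩ := hb
    refine ⟨R + R', ?_⟩
    rw [map_add, map_add, hR, hR', auxD_add, map_add, map_add]; ring
  | mul_X p w ih =>
    obtain ⟨R, hR⟩ := ih
    obtain ⟨S, hS1⟩ := hS p
    obtain ⟨S', hS'⟩ := hS (X w)
    obtain ⟨k, rfl⟩ : ∃ k, m = k + 1 := ⟨m - 1, by omega⟩
    rw [auxEv_X] at hS'
    rw [map_mul, map_mul, hR, auxD_mul, auxD_X, auxEv_X, auxEv_X, map_add, map_smul, map_smul,
      map_add, smul_eq_mul, smul_eq_mul, map_mul, map_mul, hS1, hS']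
    refine ⟨S * PowerSeries.C (l (Finsupp.single w 1)) + S' * PowerSeries.C (l (auxD q p)) +
      R * (PowerSeries.C (q (X w)) + PowerSeries.X * S' + PowerSeries.X ^ (k + 1) * PowerSeries.C (l (Finsupp.single w 1)))
      + PowerSeries.X ^ k * PowerSeries.C (l (auxD q p)) * PowerSeries.C (l (Finsupp.single w 1)), ?_⟩
    ring

theorem auxLift {K E W : Type} [Field K] [Field E] {n : ℕ}
    (q : MvPolynomial (Fin n × ℕ) K →+* E) (F : W → MvPolynomial (Fin n × ℕ) K)
    (hF : ∀ w, q (F w) = 0)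
    (hinj : Function.Injective (Finsupp.linearCombination E (fun w => auxD q (F w))))
    (l : (Fin n × ℕ →₀ E) →ₗ[E] E) (hl : ∀ w, l (auxD q (F w)) = 0) :
    ∃ Ψ : MvPolynomial (Fin n × ℕ) K →+* PowerSeries E,
      (∀ g, PowerSeries.constantCoeff (Ψ g) = q g) ∧
      (∀ g, PowerSeries.coeff 1 (Ψ g) = l (auxD q g)) ∧ ∀ w, Ψ (F w) = 0 := by
  obtain ⟨G, hG⟩ := LinearMap.exists_leftInverse_of_injective _ (LinearMap.ker_eq_bot.2 hinj)
  have hsol : ∀ b : W → E, ∃ u : (Fin n × ℕ →₀ E) →ₗ[E] E, ∀ w, u (auxD q (F w)) = b w := by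
    intro b
    refine ⟨(Finsupp.linearCombination E b).comp G, fun w => ?_⟩
    have := LinearMap.congr_fun hG (Finsupp.single w 1)
    simp only [LinearMap.comp_apply, Finsupp.linearCombination_single, one_smul, LinearMap.id_apply] at this
    rw [LinearMap.comp_apply, this]; simp
  let P : ℕ → (Fin n × ℕ → PowerSeries E) → Prop := fun N x =>
    (∀ v, PowerSeries.constantCoeff (x v) = q (X v)) ∧
    ∀ w, (PowerSeries.X : PowerSeries E) ^ (N + 2) ∣ auxEv q x (F w)
  let x0 : Fin n × ℕ → PowerSeries E := fun v => PowerSeries.C (q (X v))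
  have hx0 : ∀ v, PowerSeries.constantCoeff (x0 v) = q (X v) := fun v => by simp [x0]
  have hx0' : ∀ g, auxEv q x0 g = PowerSeries.C (q g) := fun g => by
    have : auxEv q x0 = (PowerSeries.C).comp q := by
      apply MvPolynomial.ringHom_ext
      · intro a; simp [auxEv_C]
      · intro v; simp [auxEv_X, x0]
    rw [this]; rfl
  let x1 : Fin n × ℕ → PowerSeries E :=
    fun v => x0 v + PowerSeries.X ^ 1 * PowerSeries.C (l (Finsupp.single v 1))
  have hx1 : P 0 x1 := by
    refine ⟨fun v => by simp [x1, x0], fun w => ?_⟩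
    obtain ⟨R, hR⟩ := auxEv_taylor q x0 hx0 l 1 le_rfl (F w)
    rw [hx0', hF, hl] at hR
    exact ⟨R, by rw [show x1 = _ from rfl, hR]; simp⟩
  have hstep : ∀ N x, P N x → ∃ x', P (N + 1) x' ∧
      ∀ v, (PowerSeries.X : PowerSeries E) ^ (N + 2) ∣ x' v - x v := by
    rintro N x ⟨h1, h2⟩
    choose B hB using h2
    obtain ⟨u, hu⟩ := hsol (fun w => - PowerSeries.constantCoeff (B w))
    refine ⟨fun v => x v + PowerSeries.X ^ (N + 2) * PowerSeries.C (u (Finsupp.single v 1)), ⟨?_, ?_⟩, ?_⟩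
    · intro v; simp [h1]
    · intro w
      obtain ⟨R, hR⟩ := auxEv_taylor q x h1 u (N + 2) (by omega) (F w)
      have : PowerSeries.X ∣ B w - PowerSeries.C (PowerSeries.constantCoeff (B w)) := by
        rw [PowerSeries.X_dvd_iff]; simp
      obtain ⟨S, hS⟩ := this
      rw [hR, hB, hu, map_neg]
      refine ⟨S + R, ?_⟩
      linear_combination (PowerSeries.X ^ (N + 2)) * hS
    · intro v; simp
  choose nxt hnxt1 hnxt2 using hstep
  let seq : (N : ℕ) → {x // P N x} := fun N =>
    Nat.rec (motive := fun N => {x // P N x}) ⟨x1, hx1⟩ (fun N x => ⟨nxt N x.1 x.2, hnxt1 N x.1 x.2⟩) N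
  have hseq : ∀ N v, (PowerSeries.X : PowerSeries E) ^ (N + 2) ∣ (seq (N + 1)).1 v - (seq N).1 v :=
    fun N v => hnxt2 N (seq N).1 (seq N).2 v
  have hseq2 : ∀ N k v, (PowerSeries.X : PowerSeries E) ^ (N + 2) ∣ (seq (N + k)).1 v - (seq N).1 v := by
    intro N k v
    induction k with
    | zero => simp
    | succ k ih =>
      have h1 := (pow_dvd_pow (PowerSeries.X : PowerSeries E) (show N + 2 ≤ N + k + 2 by omega)).trans
        (hseq (N + k) v)
      have := dvd_add h1 ih
      rw [sub_add_sub_cancel] at this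
      exact this
  let x : Fin n × ℕ → PowerSeries E := fun v => PowerSeries.mk fun k => PowerSeries.coeff k ((seq k).1 v)
  have hx : ∀ N v, (PowerSeries.X : PowerSeries E) ^ (N + 2) ∣ x v - (seq N).1 v := by
    intro N v
    rw [PowerSeries.X_pow_dvd_iff]
    intro m hm
    simp only [x, map_sub, PowerSeries.coeff_mk]
    rcases le_total m N with h | h
    · have := PowerSeries.X_pow_dvd_iff.1 (hseq2 m (N - m) v) m (by omega)
      rw [Nat.add_sub_cancel' h, map_sub, sub_eq_zero] at this
      rw [this, sub_self]
    · have := PowerSeries.X_pow_dvd_iff.1 (hseq2 N (m - N) v) m (by omega)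
      rw [Nat.add_sub_cancel' h, map_sub] at this
      exact this
  have hev : ∀ N g, (PowerSeries.X : PowerSeries E) ^ (N + 2) ∣ auxEv q x g - auxEv q (seq N).1 g :=
    fun N => auxEv_congr q x _ _ (hx N)
  refine ⟨auxEv q x, ?_, ?_, ?_⟩
  · refine auxEv_const q x fun v => ?_
    have := PowerSeries.X_pow_dvd_iff.1 (hx 0 v) 0 (by omega)
    rw [map_sub, sub_eq_zero, PowerSeries.coeff_zero_eq_constantCoeff_apply, PowerSeries.coeff_zero_eq_constantCoeff_apply] at this
    rw [this]; exact (seq 0).2.1 v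
  · intro g
    have := PowerSeries.X_pow_dvd_iff.1 (hev 0 g) 1 (by omega)
    rw [map_sub, sub_eq_zero] at this
    rw [this]
    obtain ⟨R, hR⟩ := auxEv_taylor q x0 hx0 l 1 le_rfl g
    change PowerSeries.coeff 1 (auxEv q x1 g) = _
    rw [show x1 = _ from rfl, hR, hx0']
    rw [map_add, map_add, PowerSeries.coeff_X_pow_mul', PowerSeries.coeff_X_pow_mul']
    simp [PowerSeries.coeff_C]
  · intro w
    ext m
    rw [map_zero]
    have h1 := PowerSeries.X_pow_dvd_iff.1 (hev m (F w)) m (by omega)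
    have h2 := PowerSeries.X_pow_dvd_iff.1 ((seq m).2.2 w) m (by omega)
    rw [map_sub, h2, sub_zero] at h1
    exact h1


theorem aux_leib {A : Type} [CommRing A] (D : A → A) (hadd : ∀ a b, D (a + b) = D a + D b)
    (hmul : ∀ a b, D (a * b) = a * D b + b * D a) (m : ℕ) (a b : A) :
    D^[m] (a * b) = ∑ ij ∈ Finset.HasAntidiagonal.antidiagonal m, (m.choose ij.1) • (D^[ij.1] a * D^[ij.2] b) := by
  let D' : A →+ A := AddMonoidHom.mk' D hadd
  have hsum : ∀ (s : Finset (ℕ × ℕ)) (c : ℕ × ℕ → ℕ) (g : ℕ × ℕ → A),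
      D (∑ i ∈ s, c i • g i) = ∑ i ∈ s, c i • D (g i) := fun s c g => by
    change D' _ = ∑ i ∈ s, c i • D' (g i)
    rw [map_sum]
    exact Finset.sum_congr rfl fun i _ => map_nsmul D' _ _
  induction m with
  | zero => simp
  | succ m ih =>
    rw [Function.iterate_succ_apply', ih, hsum,
      Finset.sum_antidiagonal_choose_succ_nsmul (fun i j => D^[i] a * D^[j] b), ← Finset.sum_add_distrib]
    refine Finset.sum_congr rfl fun ij hij => ?_
    have : m.choose ij.2 = m.choose ij.1 := by
      rw [Finset.HasAntidiagonal.mem_antidiagonal] at hij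
      exact (Nat.choose_symm_of_eq_add (by omega)).symm
    rw [this, hmul, smul_add, Function.iterate_succ_apply', Function.iterate_succ_apply', mul_comm (D^[ij.2] b)]

theorem aux_core {A : Type} [CommRing A] (D : A → A) (hadd : ∀ a b, D (a + b) = D a + D b)
    (hmul : ∀ a b, D (a * b) = a * D b + b * D a) (Q : Ideal A) (hQ : Q.IsPrime)
    (hchar : ∀ m : ℕ, m ≠ 0 → (m : A) ∉ Q) :
    ∃ I : Ideal A, I.IsPrime ∧ (∀ g ∈ I, D g ∈ I) ∧ ∀ a, a ∈ I ↔ ∀ k, D^[k] a ∈ Q := by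
  let D' : A →+ A := AddMonoidHom.mk' D hadd
  have hit0 : ∀ k, D^[k] 0 = 0 := fun k => by
    change D'^[k] 0 = 0
    simp
  have hitadd : ∀ k a b, D^[k] (a + b) = D^[k] a + D^[k] b := fun k a b => by
    change D'^[k] _ = D'^[k] a + D'^[k] b
    simp
  let I : Ideal A :=
    { carrier := {a | ∀ k, D^[k] a ∈ Q}
      zero_mem' := fun k => by rw [hit0]; exact zero_mem _
      add_mem' := fun {a b} ha hb k => by rw [hitadd]; exact add_mem (ha k) (hb k)
      smul_mem' := fun c x hx k => by
        rw [smul_eq_mul, aux_leib D hadd hmul]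
        refine Ideal.sum_mem _ fun ij _ => ?_
        exact Submodule.smul_of_tower_mem _ _ (Ideal.mul_mem_left _ _ (hx _)) }
  have hI : ∀ a, a ∈ I ↔ ∀ k, D^[k] a ∈ Q := fun a => Iff.rfl
  refine ⟨I, ?_, fun g hg => ?_, hI⟩
  · refine Ideal.isPrime_iff.2 ⟨fun h => ?_, fun {a b} hab => ?_⟩
    · have := (hI 1).1 (h ▸ Submodule.mem_top) 0
      exact hQ.ne_top ((Ideal.eq_top_iff_one _).2 this)
    · by_contra hcon
      push Not at hcon
      obtain ⟨ha, hb⟩ := hcon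
      rw [hI] at ha hb
      push Not at ha hb
      classical
      have ha1 := Nat.find_spec ha
      have ha2 : ∀ i, i < Nat.find ha → D^[i] a ∈ Q := fun i hi => not_not.1 (Nat.find_min ha hi)
      have hb1 := Nat.find_spec hb
      have hb2 : ∀ i, i < Nat.find hb → D^[i] b ∈ Q := fun i hi => not_not.1 (Nat.find_min hb hi)
      set k := Nat.find ha
      set l := Nat.find hb
      have h := (hI _).1 hab (k + l)
      rw [aux_leib D hadd hmul, ← Finset.add_sum_erase _ _ (show (k, l) ∈ Finset.HasAntidiagonal.antidiagonal (k + l) by simp)] at h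
      have hrest : ∑ ij ∈ (Finset.HasAntidiagonal.antidiagonal (k + l)).erase (k, l),
          ((k + l).choose ij.1) • (D^[ij.1] a * D^[ij.2] b) ∈ Q := by
        refine Ideal.sum_mem _ fun ij hij => ?_
        rw [Finset.mem_erase, Finset.HasAntidiagonal.mem_antidiagonal] at hij
        obtain ⟨h1, h2⟩ := hij
        refine Submodule.smul_of_tower_mem _ _ ?_
        rcases lt_or_ge ij.1 k with h3 | h3
        · exact Ideal.mul_mem_right _ _ (ha2 _ h3)
        · refine Ideal.mul_mem_left _ _ (hb2 _ ?_)
          by_contra h4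
          exact h1 (Prod.ext (by simp; omega) (by simp; omega))
      rw [Ideal.add_mem_iff_left _ hrest, nsmul_eq_mul] at h
      rcases hQ.mem_or_mem h with h | h
      · exact hchar _ (Nat.choose_pos (Nat.le_add_right k l)).ne' h
      · rcases hQ.mem_or_mem h with h | h
        · exact ha1 h
        · exact hb1 h
  · rw [hI] at hg ⊢
    intro k
    rw [← Function.iterate_succ_apply]
    exact hg (k + 1)

theorem aux_kill {K E : Type} [Field K] [CharZero K] [Field E] {n r : ℕ}
    (q : MvPolynomial (Fin n × ℕ) K →+* E) (D : MvPolynomial (Fin n × ℕ) K → MvPolynomial (Fin n × ℕ) K)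
    (hadd : ∀ a b, D (a + b) = D a + D b)
    (hmul : ∀ a b, D (a * b) = a * D b + b * D a)
    (f : Fin r → MvPolynomial (Fin n × ℕ) K)
    (𝔓 : Ideal (MvPolynomial (Fin n × ℕ) K)) (hq : ∀ g, q g = 0 ↔ g ∈ 𝔓)
    (hfP : ∀ t k, D^[k] (f t) ∈ 𝔓)
    (hmin : ∀ Q : Ideal (MvPolynomial (Fin n × ℕ) K), Q.IsPrime → (∀ g ∈ Q, D g ∈ Q) →
      (∀ t, f t ∈ Q) → Q ≤ 𝔓 → Q = 𝔓)
    (hinj : Function.Injective (auxPhi q D f))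
    (l : (Fin n × ℕ →₀ E) →ₗ[E] E) (hl : ∀ w, l (auxPhi q D f w) = 0) :
    ∀ g ∈ 𝔓, l (auxD q g) = 0 := by
  obtain ⟨Ψ, h0, h1, h2⟩ := auxLift q (fun w : Fin r × ℕ => D^[w.2] (f w.1))
    (fun w => (hq _).2 (hfP _ _)) hinj l (fun w => by
      have := hl (Finsupp.single w 1)
      rwa [auxPhi_single, one_smul] at this)
  have hK : ∀ a ∈ RingHom.ker Ψ, a ∈ 𝔓 := fun a ha => by
    rw [← hq, ← h0, (RingHom.mem_ker).1 ha, map_zero]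
  have hpr : (RingHom.ker Ψ).IsPrime := RingHom.ker_isPrime _
  obtain ⟨I, hI1, hI2, hI3⟩ := aux_core D hadd hmul (RingHom.ker Ψ) hpr (fun m hm h => by
    apply hpr.ne_top
    refine Ideal.eq_top_of_isUnit_mem _ h ?_
    have : (m : MvPolynomial (Fin n × ℕ) K) = C (m : K) := by simp
    rw [this]
    exact (IsUnit.mk0 _ (Nat.cast_ne_zero.2 hm)).map C)
  have := hmin I hI1 hI2 (fun t => (hI3 _).2 fun k => h2 (t, k)) (fun a ha => hK a ((hI3 a).1 ha 0))
  intro g hg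
  rw [← this, hI3] at hg
  have : g ∈ RingHom.ker Ψ := hg 0
  rw [← h1, (RingHom.mem_ker).1 this, map_zero]

end


section
open MvPolynomial

theorem aux_rank {K E : Type} [Field K] [Field E] {n r : ℕ}
    (q : MvPolynomial (Fin n × ℕ) K →+* E) (D : MvPolynomial (Fin n × ℕ) K → MvPolynomial (Fin n × ℕ) K)
    (f : Fin r → MvPolynomial (Fin n × ℕ) K) (i : ℕ) {ι κ : Type} [Fintype ι] [Fintype κ]
    (ρ : ι → Fin r × Fin i) (hρ : Function.Surjective ρ) (c : κ → Fin n × ℕ) (J : Matrix ι κ E)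
    (hJ : ∀ a b, J a b = auxD q (D^[((ρ a).2 : ℕ)] (f (ρ a).1)) (c b)) :
    r * i = Module.finrank E (auxDeg E r i ⊓ LinearMap.ker
      ((LinearMap.pi fun b => Finsupp.lapply (c b)).comp (auxPhi q D f) :
        (Fin r × ℕ →₀ E) →ₗ[E] (κ → E)) : Submodule E (Fin r × ℕ →₀ E)) + J.rank := by
  set T : (Fin r × ℕ →₀ E) →ₗ[E] (κ → E) :=
    (LinearMap.pi fun b => Finsupp.lapply (c b)).comp (auxPhi q D f) with hT
  have h := aux_abs_rn (auxDeg E r i) T inferInstance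
  rw [aux_deg_finrank] at h
  rw [h, Matrix.rank_eq_finrank_span_row]
  have : (auxDeg E r i).map T = Submodule.span E (Set.range J.row) := by
    have hs : auxDeg E r i = Submodule.span E
        ((fun a : Fin r × ℕ => Finsupp.single a (1 : E)) '' {v | v.2 < i}) :=
      Finsupp.supported_eq_span_single _ _
    rw [hs, Submodule.map_span]
    congr 1
    ext y
    simp only [Set.mem_image, Set.mem_range, exists_exists_and_eq_and, Set.mem_ofPred_eq]
    have key : ∀ w : Fin r × ℕ, T (Finsupp.single w 1) = fun b => auxD q (D^[w.2] (f w.1)) (c b) := by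
      intro w
      ext b
      simp [hT, auxPhi_single]
    constructor
    · rintro ⟨w, hw, rfl⟩
      obtain ⟨a, ha⟩ := hρ (w.1, ⟨w.2, hw⟩)
      refine ⟨a, ?_⟩
      rw [key]
      ext b
      change J a b = _
      rw [hJ, ha]
    · rintro ⟨a, rfl⟩
      refine ⟨((ρ a).1, ((ρ a).2 : ℕ)), (ρ a).2.2, ?_⟩
      rw [key]
      ext b
      change _ = J a b
      rw [hJ]
  rw [this]

theorem aux_inj {K E : Type} [Field K] [Field E] {n r : ℕ}
    (q : MvPolynomial (Fin n × ℕ) K →+* E) (D : MvPolynomial (Fin n × ℕ) K → MvPolynomial (Fin n × ℕ) K)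
    (f : Fin r → MvPolynomial (Fin n × ℕ) K) (e : ℕ) 
    (J : ∀ i : ℕ, Matrix (Fin r × Fin i) (Fin n × Fin (i + e)) E)
    (hJ : ∀ i a b, J i a b = q (pderiv (b.1, (b.2 : ℕ)) (D^[(a.2 : ℕ)] (f a.1))))
    (hr : ∀ i, 1 ≤ i → (J i).rank = r * i) : Function.Injective (auxPhi q D f) := by
  rw [injective_iff_map_eq_zero]
  intro v hv
  obtain ⟨d, hd⟩ := aux_deg_exists v
  have h := aux_rank q D f (d + 1) id Function.surjective_id
    (fun b : Fin n × Fin (d + 1 + e) => (b.1, (b.2 : ℕ))) (J (d + 1)) (fun a b => hJ _ a b)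
  rw [hr _ (by omega)] at h
  set S := (auxDeg E r (d + 1) ⊓ LinearMap.ker
      ((LinearMap.pi fun b : Fin n × Fin (d + 1 + e) => Finsupp.lapply (b.1, (b.2 : ℕ))).comp (auxPhi q D f) :
        (Fin r × ℕ →₀ E) →ₗ[E] (_ → E)) : Submodule E (Fin r × ℕ →₀ E)) with hS
  have hfd : FiniteDimensional E S := aux_abs_le _ _ inf_le_left inferInstance
  have h0 : Module.finrank E S = 0 := by omega
  have hb : S = ⊥ := Submodule.finrank_eq_zero.1 h0
  have : v ∈ S := by
    refine Submodule.mem_inf.2 ⟨aux_deg_mono (by omega) hd, ?_⟩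
    rw [LinearMap.mem_ker, LinearMap.comp_apply, hv, map_zero]
  rw [hb] at this
  exact (Submodule.mem_bot E).1 this

theorem aux_ordD {K E : Type} [Field K] [Field E] {n r : ℕ}
    (q : MvPolynomial (Fin n × ℕ) K →+* E) (D : MvPolynomial (Fin n × ℕ) K → MvPolynomial (Fin n × ℕ) K)
    (f : Fin r → MvPolynomial (Fin n × ℕ) K) (e : ℕ) (δ : E →+ E)
    (hDq : ∀ g, auxD q (D g) = auxPar n δ (auxD q g))
    (he : ∀ t, ∀ w ∈ (f t).vars, w.2 ≤ e) (k : ℕ) (v : Fin r × ℕ →₀ E) (hv : v ∈ auxDeg E r k) :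
    auxPhi q D f v ∈ auxDeg E n (e + k) := by
  have h1 : ∀ p t, auxD q (D^[p] (f t)) ∈ auxDeg E n (e + 1 + p) := by
    intro p t
    induction p with
    | zero =>
      rw [aux_mem_deg]
      intro j l hl
      rw [auxD_apply, Function.iterate_zero, id, pderiv_eq_zero_of_notMem_vars, map_zero]
      intro h
      have := he t _ h
      simp at this
      omega
    | succ p ih =>
      rw [Function.iterate_succ_apply', hDq, ← add_assoc, aux_der_mem δ.map_zero (auxPar_der δ)]
      exact ih
  have h2 : auxDeg E r k ≤ (auxDeg E n (e + k)).comap (auxPhi q D f) := by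
    have hs : auxDeg E r k = Submodule.span E
        ((fun a : Fin r × ℕ => Finsupp.single a (1 : E)) '' {v | v.2 < k}) :=
      Finsupp.supported_eq_span_single _ _
    rw [hs, Submodule.span_le]
    rintro _ ⟨w, hw, rfl⟩
    change auxPhi q D f (Finsupp.single w 1) ∈ auxDeg E n (e + k)
    rw [auxPhi_single, one_smul]
    have hw' : w.2 < k := hw
    exact aux_deg_mono (by omega) (h1 w.2 w.1)
  exact h2 hv

theorem aux_mu {K E : Type} [Field K] [Field E] {n r : ℕ}
    (q : MvPolynomial (Fin n × ℕ) K →+* E) (D : MvPolynomial (Fin n × ℕ) K → MvPolynomial (Fin n × ℕ) K)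
    (f : Fin r → MvPolynomial (Fin n × ℕ) K) (e k : ℕ) 
    (hord : ∀ v ∈ auxDeg E r k, auxPhi q D f v ∈ auxDeg E n (e + k))
    (J : Matrix (Fin k × Fin r) (Fin k × Fin n) E)
    (hJ : ∀ a b, J a b = q (pderiv (b.2, e + (b.1 : ℕ)) (D^[(a.1 : ℕ)] (f a.2)))) :
    k * r - J.rank = Module.finrank E ((auxDeg E n e).comap (auxPhi q D f) ⊓ auxDeg E r k :
      Submodule E (Fin r × ℕ →₀ E)) := by
  have h := aux_rank q D f k Prod.swap Prod.swap_surjective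
    (fun b : Fin k × Fin n => (b.2, e + (b.1 : ℕ))) J (fun a b => hJ a b)
  have : (auxDeg E r k ⊓ LinearMap.ker
      ((LinearMap.pi fun b : Fin k × Fin n => Finsupp.lapply (b.2, e + (b.1 : ℕ))).comp (auxPhi q D f) :
        (Fin r × ℕ →₀ E) →ₗ[E] (_ → E)) : Submodule E (Fin r × ℕ →₀ E)) = 
      (auxDeg E n e).comap (auxPhi q D f) ⊓ auxDeg E r k := by
    rw [inf_comm]
    ext v
    simp only [Submodule.mem_inf, LinearMap.mem_ker, Submodule.mem_comap]
    refine and_congr_left fun hv => ?_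
    rw [aux_mem_deg]
    constructor
    · intro h j l hl
      rcases lt_or_ge l (e + k) with h3 | h3
      · have := congrFun h (⟨l - e, by omega⟩, j)
        simp only [LinearMap.comp_apply, LinearMap.pi_apply, Finsupp.lapply_apply, Pi.zero_apply] at this
        rwa [Nat.add_sub_cancel' hl] at this
      · exact aux_mem_deg.1 (hord v hv) j l h3
    · intro h
      ext b
      exact h _ _ (Nat.le_add_right _ _)
  rw [this] at h
  rw [mul_comm k r]
  omega
end


section
open MvPolynomial

/-- the map to Kaehler differentials -/
noncomputable def auxPi {K E : Type} [Field K] [Field E] [Algebra K E] {n : ℕ}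
    (q : MvPolynomial (Fin n × ℕ) K →+* E) : (Fin n × ℕ →₀ E) →ₗ[E] Ω[E⁄K] :=
  Finsupp.linearCombination E (fun v => KaehlerDifferential.D K E (q (X v)))

theorem auxPi_single {K E : Type} [Field K] [Field E] [Algebra K E] {n : ℕ}
    (q : MvPolynomial (Fin n × ℕ) K →+* E) (v : Fin n × ℕ) (c : E) :
    auxPi q (Finsupp.single v c) = c • KaehlerDifferential.D K E (q (X v)) := by
  rw [auxPi, Finsupp.linearCombination_single]

theorem auxPi_D {K E : Type} [Field K] [Field E] [Algebra K E] {n : ℕ}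
    (q : MvPolynomial (Fin n × ℕ) K →+* E) (hq : ∀ a, q (C a) = algebraMap K E a)
    (g : MvPolynomial (Fin n × ℕ) K) : auxPi q (auxD q g) = KaehlerDifferential.D K E (q g) := by
  induction g using MvPolynomial.induction_on with
  | C a => rw [auxD_C, map_zero, hq, Derivation.map_algebraMap]
  | add a b ha hb => rw [auxD_add, map_add, ha, hb, map_add, map_add]
  | mul_X p w ih =>
    rw [auxD_mul, map_add, map_smul, map_smul, ih, auxD_X, auxPi_single, one_smul, map_mul,
      Derivation.leibniz]

theorem auxPi_ker {K E : Type} [Field K] [CharZero K] [Field E] [Algebra K E] {n r : ℕ}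
    (𝔓 : Ideal (MvPolynomial (Fin n × ℕ) K)) [𝔓.IsPrime] 
    [Algebra (MvPolynomial (Fin n × ℕ) K ⧸ 𝔓) E] [IsFractionRing (MvPolynomial (Fin n × ℕ) K ⧸ 𝔓) E]
    (q : MvPolynomial (Fin n × ℕ) K →+* E)
    (hqq : ∀ a, q a = algebraMap (MvPolynomial (Fin n × ℕ) K ⧸ 𝔓) E (Ideal.Quotient.mk 𝔓 a))
    (hqC : ∀ a, q (C a) = algebraMap K E a)
    (hq : ∀ g, q g = 0 ↔ g ∈ 𝔓)
    (D : MvPolynomial (Fin n × ℕ) K → MvPolynomial (Fin n × ℕ) K)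
    (f : Fin r → MvPolynomial (Fin n × ℕ) K)
    (hfP : ∀ t k, D^[k] (f t) ∈ 𝔓)
    (hkill : ∀ l : (Fin n × ℕ →₀ E) →ₗ[E] E, (∀ w, l (auxPhi q D f w) = 0) →
      ∀ g ∈ 𝔓, l (auxD q g) = 0) :
    LinearMap.ker (auxPi q) = LinearMap.range (auxPhi q D f) := by
  apply le_antisymm
  · intro x hx
    by_contra hcon
    obtain ⟨l, hl1, hl2⟩ := Submodule.exists_le_ker_of_notMem hcon
    have hl : ∀ w, l (auxPhi q D f w) = 0 := fun w => hl2 ⟨w, rfl⟩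
    obtain ⟨d', hd1, hd2⟩ := aux_ext_der (E := E) 𝔓 (fun g => l (auxD q g))
      (fun a b => by rw [auxD_add, map_add])
      (fun a b => by rw [auxD_mul, map_add, map_smul, map_smul, smul_eq_mul, smul_eq_mul, hqq, hqq])
      (hkill l hl)
    simp only [← hqq] at hd2
    have hK : ∀ a : K, d' (algebraMap K E a) = 0 := fun a => by
      rw [← hqC, hd2, auxD_C, map_zero]
    let d'' : E →ₗ[K] E :=
      { toFun := d'
        map_add' := d'.map_add
        map_smul' := fun a b => by
          rw [Algebra.smul_def, hd1, hK, mul_zero, add_zero, RingHom.id_apply, Algebra.smul_def] }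
    let dd : Derivation K E E := Derivation.mk' d'' (fun a b => by
      change d' (a * b) = a • d' b + b • d' a
      rw [hd1]; rfl)
    have hL : dd.liftKaehlerDifferential.comp (auxPi q) = l := by
      apply Finsupp.lhom_ext
      intro v c
      rw [LinearMap.comp_apply, auxPi_single, map_smul, Derivation.liftKaehlerDifferential_comp_D]
      change c • d' (q (X v)) = _
      rw [hd2, auxD_X, ← map_smul, Finsupp.smul_single, smul_eq_mul, mul_one]
    apply hl1
    rw [← hL, LinearMap.comp_apply, (LinearMap.mem_ker).1 hx, map_zero]
  · rintro _ ⟨w, rfl⟩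
    rw [LinearMap.mem_ker]
    induction w using Finsupp.induction_linear with
    | zero => simp
    | add u v hu hv => rw [map_add, map_add, hu, hv, add_zero]
    | single w c =>
      rw [auxPhi_single, map_smul, auxPi_D q hqC, (hq _).2 (hfP _ _), map_zero, smul_zero]

theorem aux_abs_inj {F V W : Type} [Field F] [AddCommGroup V] [Module F V] [AddCommGroup W]
    [Module F W] (f : V →ₗ[F] W) (hf : Function.Injective f) (S : Submodule F W) :
    Module.finrank F (S ⊓ LinearMap.range f : Submodule F W) = Module.finrank F (S.comap f) := by
  rw [inf_comm, ← Submodule.map_comap_eq]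
  exact (Submodule.equivMapOfInjective f hf _).finrank_eq.symm

theorem aux_pi_map {K E : Type} [Field K] [Field E] [Algebra K E] {n : ℕ}
    (q : MvPolynomial (Fin n × ℕ) K →+* E) (i : ℕ) :
    (auxDeg E n i).map (auxPi q) = Submodule.span E (Set.range fun v : Fin n × Fin i =>
      KaehlerDifferential.D K E (q (X (v.1, (v.2 : ℕ))))) := by
  have hs : auxDeg E n i = Submodule.span E
        ((fun a : Fin n × ℕ => Finsupp.single a (1 : E)) '' {v | v.2 < i}) :=
      Finsupp.supported_eq_span_single _ _
  rw [hs, Submodule.map_span]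
  congr 1
  ext y
  constructor
  · rintro ⟨_, ⟨w, hw, rfl⟩, rfl⟩
    exact ⟨(w.1, ⟨w.2, hw⟩), by rw [auxPi_single, one_smul]⟩
  · rintro ⟨a, rfl⟩
    exact ⟨_, ⟨(a.1, (a.2 : ℕ)), a.2.2, rfl⟩, by rw [auxPi_single, one_smul]⟩
end


namespace DAE

open MvPolynomial

theorem aux_order
    {K : Type} [Field K] {n : ℕ} (𝔓 : Ideal (DP K n)) [𝔓.IsPrime] (i : ℕ) :
    ∃ j : FractionRing (AP K n i ⧸ Pc i 𝔓) →ₐ[K] KK K n 𝔓,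
      ∃ g : Fin n × Fin (i + 1) → FractionRing (AP K n i ⧸ Pc i 𝔓),
        IntermediateField.adjoin K (Set.range g) = ⊤ ∧
        ∀ v, j (g v) = toKK 𝔓 (X (v.1, (v.2 : ℕ))) := by
  let h0 : AP K n i ⧸ Pc i 𝔓 →+* DP K n ⧸ 𝔓 := Ideal.quotientMap 𝔓 (inclA K n i) le_rfl
  have h0inj : Function.Injective h0 := Ideal.quotientMap_injective
  let h1 : AP K n i ⧸ Pc i 𝔓 →+* KK K n 𝔓 := (algebraMap _ _).comp h0
  have h1inj : Function.Injective h1 :=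
    (IsFractionRing.injective (DP K n ⧸ 𝔓) (KK K n 𝔓)).comp h0inj
  let h2 : FractionRing (AP K n i ⧸ Pc i 𝔓) →+* KK K n 𝔓 := IsFractionRing.lift h1inj
  have hh2 : ∀ p : AP K n i, h2 (algebraMap _ _ (Ideal.Quotient.mk (Pc i 𝔓) p)) =
      toKK 𝔓 (inclA K n i p) := by
    intro p
    exact IsFractionRing.lift_algebraMap h1inj _
  let j : FractionRing (AP K n i ⧸ Pc i 𝔓) →ₐ[K] KK K n 𝔓 :=
    { h2 with
      commutes' := fun a => by
        have := hh2 (C a)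
        have e1 : inclA K n i (C a) = C a := by simp [inclA]
        rw [e1] at this
        exact this }
  refine ⟨j, fun v => algebraMap _ _ (Ideal.Quotient.mk (Pc i 𝔓) (X v)), ?_, fun v => ?_⟩
  · rw [eq_top_iff]
    intro x _
    have hp : ∀ p : AP K n i, algebraMap _ (FractionRing (AP K n i ⧸ Pc i 𝔓)) (Ideal.Quotient.mk (Pc i 𝔓) p) ∈
        IntermediateField.adjoin K (Set.range fun v : Fin n × Fin (i + 1) =>
          algebraMap _ (FractionRing (AP K n i ⧸ Pc i 𝔓)) (Ideal.Quotient.mk (Pc i 𝔓) (X v))) := by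
      intro p
      induction p using MvPolynomial.induction_on with
      | C a => exact IntermediateField.algebraMap_mem _ a
      | add a b ha hb => rw [map_add, map_add]; exact add_mem ha hb
      | mul_X p w ih =>
        rw [map_mul, map_mul]
        exact mul_mem ih (IntermediateField.subset_adjoin _ _ ⟨w, rfl⟩)
    obtain ⟨a, b, hb, rfl⟩ := IsFractionRing.div_surjective (A := AP K n i ⧸ Pc i 𝔓) x
    obtain ⟨a, rfl⟩ := Ideal.Quotient.mk_surjective a
    obtain ⟨b, rfl⟩ := Ideal.Quotient.mk_surjective b
    exact div_mem (hp a) (hp b)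
  · have := hh2 (X v)
    have e1 : inclA K n i (X v) = X (v.1, (v.2 : ℕ)) := by simp [inclA]
    rw [e1] at this
    exact this

/-- The order of `𝔓` equals `er − μ_σ`, where `σ` is the
`𝔓`-differentiation index: if `c` satisfies `trdeg_K Frac(A_i/(A_i∩𝔓)) =
(n−r)(i+1)+c` for all large `i` (i.e. `c = ord 𝔓`), then `c = er − μ_σ`. -/
theorem order_eq_er_sub_mu_sigma
    {K : Type} [Field K] [CharZero K] {n r : ℕ} (hrn : r ≤ n)
    (δ : K → K) (hδ : IsDeriv K δ)
    (D : DP K n → DP K n) (hD : IsTotalDeriv K n δ D)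
    (f : Fin r → DP K n)
    (e : ℕ) (he : e = Finset.univ.sup fun p : Fin r × Fin n => ordIn (f p.1) p.2)
    (he1 : 1 ≤ e)
    (𝔓 : Ideal (DP K n)) [𝔓.IsPrime]
    (hmin : IsMinimalPrimeDiff D f 𝔓)
    (hqr : IsQuasiRegularAt D f 𝔓 e)
    (hsr : StandingRank D f 𝔓 e)
    (σ : ℕ)
    (hσ : ∀ k : ℕ,
      (k < σ → mu D f 𝔓 e k (e - 1) < mu D f 𝔓 e (k + 1) (e - 1)) ∧
      (σ ≤ k → mu D f 𝔓 e k (e - 1) = mu D f 𝔓 e (k + 1) (e - 1)))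
    (c : ℕ)
    (hord : ∃ i₀ : ℕ, ∀ i : ℕ, i₀ ≤ i →
      HasTrdeg K (FractionRing (AP K n i ⧸ Pc i 𝔓)) ((n - r) * (i + 1) + c)) :
    (c : ℤ) = (e : ℤ) * r - (mu D f 𝔓 e σ (e - 1) : ℤ) := by
  obtain ⟨-, hPD, hPf, hPmin⟩ := hmin
  have hq : ∀ g, toKK 𝔓 g = 0 ↔ g ∈ 𝔓 := fun g => by
    change algebraMap (DP K n ⧸ 𝔓) (KK K n 𝔓) (Ideal.Quotient.mk 𝔓 g) = 0 ↔ _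
    rw [IsFractionRing.to_map_eq_zero_iff, Ideal.Quotient.eq_zero_iff_mem]
  have hfP : ∀ t k, D^[k] (f t) ∈ 𝔓 := fun t k => by
    induction k with
    | zero => exact hPf t
    | succ k ih => rw [Function.iterate_succ_apply']; exact hPD _ ih
  obtain ⟨δ', hδ1, hδ2⟩ := aux_ext_der (E := KK K n 𝔓) 𝔓 (fun g => toKK 𝔓 (D g))
    (fun a b => by rw [hD.map_add, map_add])
    (fun a b => by rw [hD.leibniz, map_add, map_mul, map_mul]; rfl)
    (fun g hg => (hq _).2 (hPD g hg))
  have hδq : ∀ a, δ' (toKK 𝔓 a) = toKK 𝔓 (D a) := hδ2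
  have hDq := auxD_comm (toKK 𝔓) δ D hD.map_add hD.leibniz hD.map_C hD.map_X δ' hδ1 hδq
  have hinj : Function.Injective (auxPhi (toKK 𝔓) D f) :=
    aux_inj (toKK 𝔓) D f e (fun i => qrJac D f 𝔓 e i) (fun i a b => rfl) hqr
  have hvars : ∀ t, ∀ w ∈ (f t).vars, w.2 ≤ e := by
    intro t w hw
    have h1 : w.2 ≤ ordIn (f t) w.1 :=
      Finset.le_sup (f := fun v : Fin n × ℕ => v.2) (Finset.mem_filter.2 ⟨hw, rfl⟩)
    have h2 : ordIn (f t) w.1 ≤ e := by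
      rw [he]
      exact Finset.le_sup (f := fun p : Fin r × Fin n => ordIn (f p.1) p.2) (Finset.mem_univ (t, w.1))
    exact h1.trans h2
  have hordD := aux_ordD (toKK 𝔓) D f e δ' hDq hvars
  have hmu : ∀ k, mu D f 𝔓 e k (e - 1) = Module.finrank (KK K n 𝔓)
      ((auxDeg (KK K n 𝔓) n e).comap (auxPhi (toKK 𝔓) D f) ⊓ auxDeg (KK K n 𝔓) r k :
      Submodule (KK K n 𝔓) (Fin r × ℕ →₀ KK K n 𝔓)) := by
    intro k
    refine aux_mu (toKK 𝔓) D f e k (hordD k) (Jmat D f 𝔓 e k (e - 1)) (fun a b => ?_)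
    have e1 : e - 1 + 1 = e := by omega
    simp only [Jmat, jEntry, e1, Nat.sub_self, Nat.zero_add]
  have hlin := aux_lin (δ := δ') δ'.map_zero (auxPar_der (n := n) δ') (auxPar_der (n := r) δ')
    (auxPar_add δ') (auxPhi (toKK 𝔓) D f) hinj
    (auxPhi_comm (toKK 𝔓) D δ' hδ1 hDq f) (hordD 1) σ
    (fun k hk => by rw [← hmu, ← hmu]; exact (hσ k).2 hk)
  have hkill := fun l hl => aux_kill (toKK 𝔓) D hD.map_add hD.leibniz f 𝔓 hq hfP hPmin hinj l hl
  have hker := auxPi_ker (E := KK K n 𝔓) 𝔓 (toKK 𝔓) (fun a => rfl) (fun a => rfl) hq D f hfP hkill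
  obtain ⟨i₀, hi₀⟩ := hord
  obtain ⟨i, i', hi, hii⟩ : ∃ i i', i₀ ≤ i ∧ i + 1 = e + i' := ⟨i₀ + e, i₀ + 1, by omega, by omega⟩
  obtain ⟨s, hs, hcard⟩ := hi₀ i hi
  obtain ⟨j, g, hg, hjg⟩ := aux_order 𝔓 i
  have htr := aux_trdeg j g hg _ s hs hcard
  have hfe : (fun v => KaehlerDifferential.D K (KK K n 𝔓) (j (g v))) = fun v => KaehlerDifferential.D K (KK K n 𝔓) (toKK 𝔓 (X (v.1, (v.2 : ℕ)))) := funext fun v => by rw [hjg]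
  rw [hfe] at htr
  rw [← aux_pi_map] at htr
  have hrn2 := aux_abs_rn (auxDeg (KK K n 𝔓) n (i + 1)) (auxPi (toKK 𝔓)) inferInstance
  rw [htr, aux_deg_finrank, hker, aux_abs_inj _ hinj, hii, hlin i', ← hmu] at hrn2
  obtain ⟨m, rfl⟩ := Nat.exists_eq_add_of_le hrn
  rw [Nat.add_sub_cancel_left] at hrn2
  zify at hrn2
  linear_combination -hrn2

end DAE
end
end
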